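/- Compactness of minimizing sequences: under the assumptions of the previous statement, if u_k minimizes M_{h_k} on H_coll^{q_k} for each k, then, up to extraction, u_k → u* strongly in H¹([0,1];ℝ²), and u* is a minimizer of M_{h*} on H_coll^{q*}. -/

import Mathlib

open Set MeasureTheory intervalIntegral Filter

noncomputable def Vpot (α : ℝ) (U : EuclideanSpace ℝ (Fin 2) → ℝ)
    (x : EuclideanSpace ℝ (Fin 2)) : ℝ :=
  ‖x‖ ^ (-α) * U (‖x‖⁻¹ • x)

/-- The Maupertuis functional `M_h(u) = (1/2)∫₀¹|u̇|² · ∫₀¹(h+V(u))`. -/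
noncomputable def Maupertuis (α h : ℝ) (U : EuclideanSpace ℝ (Fin 2) → ℝ)
    (u : ℝ → EuclideanSpace ℝ (Fin 2)) : ℝ :=
  ((1/2) * ∫ s in (0:ℝ)..1, ‖deriv u s‖ ^ 2) *
    (∫ s in (0:ℝ)..1, (h + Vpot α U (u s)))

/-- The class `H_coll^q`. -/
def HcollQ (α h : ℝ) (U : EuclideanSpace ℝ (Fin 2) → ℝ)
    (q : EuclideanSpace ℝ (Fin 2)) (u : ℝ → EuclideanSpace ℝ (Fin 2)) : Prop :=
  ContinuousOn u (Icc 0 1) ∧ (∀ s ∈ Ioo (0:ℝ) 1, DifferentiableAt ℝ u s) ∧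
    u 0 = q ∧ u 1 = 0 ∧ (∀ s ∈ Icc (0:ℝ) 1, ‖u s‖ ≤ ‖q‖) ∧
    (∀ᵐ s, s ∈ Icc (0:ℝ) 1 → u s ≠ 0) ∧
    IntervalIntegrable (fun s => ‖deriv u s‖ ^ 2) volume 0 1 ∧
    IntervalIntegrable (fun s => h + Vpot α U (u s)) volume 0 1

/-- The point `r e^{iθ}` of the plane. -/
noncomputable def circlePt (r θ : ℝ) : EuclideanSpace ℝ (Fin 2) :=
  r • (EuclideanSpace.equiv (Fin 2) ℝ).symm ![Real.cos θ, Real.sin θ]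

abbrev E2 := EuclideanSpace ℝ (Fin 2)

lemma Vpot_smul (α : ℝ) (U : E2 → ℝ) {c : ℝ} (hc : 0 < c) (x : E2) :
    Vpot α U (c • x) = c ^ (-α) * Vpot α U x := by
  unfold Vpot
  rw [norm_smul, Real.norm_of_nonneg hc.le, Real.mul_rpow hc.le (norm_nonneg _), smul_smul]
  have : (c * ‖x‖)⁻¹ * c = ‖x‖⁻¹ := by
    rw [mul_inv]; field_simp
  rw [this]; ring

lemma norm_unit {x : E2} (hx : x ≠ 0) : ‖‖x‖⁻¹ • x‖ = 1 := by
  rw [norm_smul, norm_inv, norm_norm, inv_mul_cancel₀ (norm_ne_zero_iff.2 hx)]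

lemma Vpot_ge {α Umin : ℝ} {U : E2 → ℝ}
    (hUmin : ∀ s : E2, ‖s‖ = 1 → Umin ≤ U s) {x : E2} (hx : x ≠ 0) :
    Umin * ‖x‖ ^ (-α) ≤ Vpot α U x := by
  unfold Vpot
  rw [mul_comm]
  exact mul_le_mul_of_nonneg_left (hUmin _ (norm_unit hx)) (Real.rpow_nonneg (norm_nonneg _) _)

lemma exists_Umax {U : E2 → ℝ} (hU : Continuous U) :
    ∃ Umax : ℝ, 0 < Umax ∧ ∀ s : E2, ‖s‖ = 1 → U s ≤ Umax := by
  obtain ⟨C, hC⟩ := (isCompact_sphere (0 : E2) 1).exists_bound_of_continuousOn hU.continuousOn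
  refine ⟨max C 1, by positivity, fun s hs => ?_⟩
  exact (le_abs_self _).trans ((hC s (by simpa using hs)).trans (le_max_left _ _))

lemma Vpot_le {α Umax : ℝ} {U : E2 → ℝ}
    (hUmax : ∀ s : E2, ‖s‖ = 1 → U s ≤ Umax) {x : E2} (hx : x ≠ 0) :
    Vpot α U x ≤ Umax * ‖x‖ ^ (-α) := by
  unfold Vpot
  rw [mul_comm]
  exact mul_le_mul_of_nonneg_right (hUmax _ (norm_unit hx)) (Real.rpow_nonneg (norm_nonneg _) _)

lemma Vpot_zero {α : ℝ} (hα : 0 < α) (U : E2 → ℝ) : Vpot α U 0 = 0 := by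
  unfold Vpot
  rw [norm_zero, Real.zero_rpow (by linarith), zero_mul]

lemma Vpot_nonneg {α Umin : ℝ} {U : E2 → ℝ} (hα : 0 < α)
    (hUmin : ∀ s : E2, ‖s‖ = 1 → Umin ≤ U s) (h0 : 0 < Umin) (x : E2) :
    0 ≤ Vpot α U x := by
  by_cases hx : x = 0
  · rw [hx, Vpot_zero hα]
  · exact le_trans (by positivity) (Vpot_ge hUmin hx)

lemma Vpot_measurable (α : ℝ) {U : E2 → ℝ} (hU : Continuous U) : Measurable (Vpot α U) := by
  unfold Vpot
  have : Measurable U := hU.measurable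
  fun_prop

lemma Vpot_contDiffAt (α : ℝ) {U : E2 → ℝ} (hU : ContDiff ℝ 2 U) {x : E2} (hx : x ≠ 0) :
    ContDiffAt ℝ 2 (Vpot α U) x := by
  unfold Vpot
  have h1 : ContDiffAt ℝ 2 (fun x : E2 => ‖x‖) x := contDiffAt_norm ℝ hx
  have hn : ‖x‖ ≠ 0 := norm_ne_zero_iff.2 hx
  refine ContDiffAt.mul (h1.rpow_const_of_ne hn) ?_
  exact hU.contDiffAt.comp x ((h1.inv hn).smul contDiffAt_id)

lemma Vpot_hasFDerivAt (α : ℝ) {U : E2 → ℝ} (hU : ContDiff ℝ 2 U) {x : E2} (hx : x ≠ 0) :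
    HasFDerivAt (Vpot α U) (fderiv ℝ (Vpot α U) x) x :=
  ((Vpot_contDiffAt α hU hx).differentiableAt (by norm_num)).hasFDerivAt

lemma Vpot_fderiv_continuousAt (α : ℝ) {U : E2 → ℝ} (hU : ContDiff ℝ 2 U) {x : E2}
    (hx : x ≠ 0) : ContinuousAt (fderiv ℝ (Vpot α U)) x :=
  ((Vpot_contDiffAt α hU hx).fderiv_right (m := 1) (by norm_num)).continuousAt

lemma Vpot_continuousAt (α : ℝ) {U : E2 → ℝ} (hU : ContDiff ℝ 2 U) {x : E2}
    (hx : x ≠ 0) : ContinuousAt (Vpot α U) x := (Vpot_contDiffAt α hU hx).continuousAt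

lemma Vpot_euler (α : ℝ) {U : E2 → ℝ} (hU : ContDiff ℝ 2 U) {x : E2} (hx : x ≠ 0) :
    fderiv ℝ (Vpot α U) x x = -α * Vpot α U x := by
  have h1 : HasDerivAt (fun c : ℝ => Vpot α U (c • x)) (fderiv ℝ (Vpot α U) x x) 1 := by
    have h2 : HasDerivAt (fun c : ℝ => c • x) ((1:ℝ) • x) 1 := (hasDerivAt_id (1:ℝ)).smul_const x
    have h3 : HasFDerivAt (Vpot α U) (fderiv ℝ (Vpot α U) x) ((1:ℝ) • x) := by
      rw [one_smul]; exact Vpot_hasFDerivAt α hU hx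
    have := h3.comp_hasDerivAt (1:ℝ) h2
    simp only [one_smul] at this
    exact this
  have h4 : HasDerivAt (fun c : ℝ => c ^ (-α) * Vpot α U x) (-α * Vpot α U x) 1 := by
    have := (Real.hasDerivAt_rpow_const (x := 1) (p := -α) (Or.inl one_ne_zero)).mul_const
      (Vpot α U x)
    simpa using this
  refine h1.unique (h4.congr_of_eventuallyEq ?_)
  filter_upwards [lt_mem_nhds (show (0:ℝ) < 1 by norm_num)] with c hc
  exact Vpot_smul α U hc x

/-- bound on the derivative on annuli -/
lemma Vpot_fderiv_bound (α : ℝ) {U : E2 → ℝ} (hU : ContDiff ℝ 2 U) {d R : ℝ} (hd : 0 < d) :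
    ∃ C : ℝ, 0 < C ∧ ∀ x : E2, d ≤ ‖x‖ → ‖x‖ ≤ R → ‖fderiv ℝ (Vpot α U) x‖ ≤ C := by
  have hK : IsCompact {x : E2 | d ≤ ‖x‖ ∧ ‖x‖ ≤ R} := by
    refine (isCompact_closedBall (0 : E2) R).of_isClosed_subset ?_ ?_
    · exact (isClosed_le continuous_const continuous_norm).inter
        (isClosed_le continuous_norm continuous_const)
    · intro x hx; simpa using hx.2
  obtain ⟨C, hC⟩ := hK.exists_bound_of_continuousOn (f := fderiv ℝ (Vpot α U))
    (fun x hx => (Vpot_fderiv_continuousAt α hU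
      (norm_pos_iff.1 (hd.trans_le hx.1))).continuousWithinAt)
  exact ⟨max C 1, by positivity, fun x h1 h2 => (hC x ⟨h1, h2⟩).trans (le_max_left _ _)⟩

lemma tail_limit {a b c ε0 : ℝ} (h0 : 0 < ε0)
    (h : ∀ ε, 0 < ε → ε < ε0 → 0 ≤ ε * (a + b * ε + c * ε ^ 2)) : 0 ≤ a := by
  have ht : Tendsto (fun ε : ℝ => a + b * ε + c * ε ^ 2) (nhdsWithin 0 (Ioi 0)) (nhds a) := by
    have : Continuous (fun ε : ℝ => a + b * ε + c * ε ^ 2) := by fun_prop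
    have := (this.tendsto 0).mono_left (nhdsWithin_le_nhds (s := Ioi 0))
    simpa using this
  refine ge_of_tendsto ht ?_
  filter_upwards [Ioo_mem_nhdsGT h0] with ε hε
  exact nonneg_of_mul_nonneg_right (h ε hε.1 hε.2) hε.1

/-- A weakly monotone derivative is monotone. -/
lemma weak_monotone {w W : ℝ → ℝ} (hW : ∀ s ∈ Ioo (0:ℝ) 1, HasDerivAt W (w s) s)
    (hinteg : ∀ a b, 0 < a → a < b → b < 1 → IntervalIntegrable w volume a b)
    (hweak : ∀ a b, 0 < a → a < b → b < 1 → ∀ η ζ : ℝ → ℝ, Continuous ζ →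
      (∀ s, HasDerivAt η (ζ s) s) → (∀ s, 0 ≤ η s) → (∀ s, s ∉ Ioo a b → η s = 0) →
      (∀ s, s ∉ Ioo a b → ζ s = 0) → ∫ s in a..b, ζ s * w s ≤ 0) :
    MonotoneOn w (Ioo 0 1) := by
  intro a ha b hb hab
  rcases hab.eq_or_lt with rfl | hab
  · exact le_rfl
  -- the difference quotient
  set d := b - a with hd
  have hd0 : 0 < d := by linarith
  have key : ∀ δ, 0 < δ → b + δ < 1 → a + δ ≤ b → W (a + δ) - W a ≤ W (b + δ) - W b := by
    intro δ hδ hδ1 hδ2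
    -- bump functions
    let β : ℕ → ℝ → ℝ := fun n s => max 0 (min 1 (n * ((s - a) * (a + δ - s))))
    have hβc : ∀ n, Continuous (β n) := fun n => by fun_prop
    have hβ0 : ∀ n s, 0 ≤ β n s := fun n s => le_max_left _ _
    have hβ1 : ∀ n s, β n s ≤ 1 := fun n s => max_le zero_le_one (min_le_left _ _)
    have hβs : ∀ n s, s ∉ Ioo a (a + δ) → β n s = 0 := by
      intro n s hs
      apply max_eq_left
      apply (min_le_right _ _).trans
      apply mul_nonpos_of_nonneg_of_nonpos (Nat.cast_nonneg n)
      rw [mem_Ioo, not_and_or, not_lt, not_lt] at hs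
      rcases hs with hs | hs
      · exact mul_nonpos_of_nonpos_of_nonneg (by linarith) (by linarith)
      · exact mul_nonpos_of_nonneg_of_nonpos (by linarith) (by linarith)
    have hβlim : ∀ s ∈ Ioo a (a + δ), Tendsto (fun n => β n s) atTop (nhds 1) := by
      intro s hs
      have hp : 0 < (s - a) * (a + δ - s) := mul_pos (by linarith [hs.1]) (by linarith [hs.2])
      apply tendsto_const_nhds.congr'
      have h1 := (tendsto_natCast_atTop_atTop (R := ℝ)).atTop_mul_const hp
      filter_upwards [h1.eventually_ge_atTop 1] with n hn
      show 1 = max 0 (min 1 _)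
      rw [min_eq_left hn, max_eq_right zero_le_one]
    have hβi : ∀ n x y, IntervalIntegrable (β n) volume x y := fun n x y =>
      (hβc n).intervalIntegrable x y
    have hI1 : IntervalIntegrable w volume a (a + δ) := hinteg _ _ ha.1 (by linarith) (by linarith)
    have hI2 : IntervalIntegrable w volume b (b + δ) := hinteg _ _ hb.1 (by linarith) (by linarith)
    have hI3 : IntervalIntegrable (fun s => w (s + d)) volume a (a + δ) := by
      have := hI2.comp_add_right d
      have e1 : b - d = a := by rw [hd]; ring
      have e2 : b + δ - d = a + δ := by rw [hd]; ring
      rwa [e1, e2] at this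
    have hD : IntervalIntegrable (fun s => w s - w (s + d)) volume a (a + δ) := hI1.sub hI3
    have hn : ∀ n, ∫ s in a..(a + δ), β n s * (w s - w (s + d)) ≤ 0 := by
      intro n
      let ζ : ℝ → ℝ := fun s => β n s - β n (s - d)
      let η : ℝ → ℝ := fun s => ∫ x in (s - d)..s, β n x
      have hη : ∀ s, η s = (∫ x in (0:ℝ)..s, β n x) - ∫ x in (0:ℝ)..(s - d), β n x := by
        intro s
        show (∫ x in (s - d)..s, β n x) = _
        rw [integral_interval_sub_left (hβi n _ _) (hβi n _ _)]
      have hder : ∀ s, HasDerivAt η (ζ s) s := by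
        intro s
        have hb : ∀ t, HasDerivAt (fun t => ∫ x in (0:ℝ)..t, β n x) (β n t) t := fun t =>
          integral_hasDerivAt_right (hβi n _ _)
            ((hβc n).stronglyMeasurableAtFilter _ _) (hβc n).continuousAt
        have h2 := (hb (s - d)).comp_sub_const s d
        exact ((hb s).sub h2).congr_of_eventuallyEq (Eventually.of_forall hη)
      have hz := hweak a (b + δ) ha.1 (by linarith) hδ1 η ζ
        ((hβc n).sub ((hβc n).comp (continuous_id.sub continuous_const))) hder
        (fun s => integral_nonneg (by linarith) (fun x _ => hβ0 n x))
        (by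
          intro s hs
          rw [mem_Ioo, not_and_or, not_lt, not_lt] at hs
          apply integral_zero_ae
          refine Eventually.of_forall fun x hx => ?_
          rw [uIoc_of_le (by linarith)] at hx
          apply hβs
          rw [mem_Ioo, not_and_or, not_lt, not_lt]
          rcases hs with hs | hs
          · left; linarith [hx.2]
          · right; linarith [hx.1])
        (by
          intro s hs
          rw [mem_Ioo, not_and_or, not_lt, not_lt] at hs
          show β n s - β n (s - d) = 0
          rw [hβs, hβs, sub_zero]
          · rw [mem_Ioo, not_and_or, not_lt, not_lt]
            rcases hs with hs | hs
            · left; linarith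
            · right; linarith
          · rw [mem_Ioo, not_and_or, not_lt, not_lt]
            rcases hs with hs | hs
            · left; linarith
            · right; linarith)
      have hIall : IntervalIntegrable w volume a (b + δ) := hinteg _ _ ha.1 (by linarith) hδ1
      have hm : ∀ x y, IntervalIntegrable w volume x y →
          IntervalIntegrable (fun s => β n s * w s) volume x y := fun x y hxy =>
        hxy.continuousOn_mul (hβc n).continuousOn
      have hm' : ∀ x y, IntervalIntegrable w volume x y →
          IntervalIntegrable (fun s => β n (s - d) * w s) volume x y := fun x y hxy =>
        hxy.continuousOn_mul ((hβc n).comp (continuous_id.sub continuous_const)).continuousOn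
      have hIb : IntervalIntegrable w volume (a + δ) (b + δ) :=
        hinteg _ _ (by linarith [ha.1]) (by linarith) hδ1
      have hIc : IntervalIntegrable w volume a b := hinteg _ _ ha.1 hab hb.2
      have s1 : ∫ s in a..(b + δ), β n s * w s = ∫ s in a..(a + δ), β n s * w s := by
        rw [← integral_add_adjacent_intervals (hm _ _ hI1) (hm _ _ hIb)]
        rw [add_eq_left]
        apply integral_zero_ae
        refine Eventually.of_forall fun x hx => ?_
        rw [uIoc_of_le (by linarith)] at hx
        rw [hβs, zero_mul]
        intro h; linarith [h.2, hx.1]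
      have s2 : ∫ s in a..(b + δ), β n (s - d) * w s =
          ∫ s in a..(a + δ), β n s * w (s + d) := by
        rw [← integral_add_adjacent_intervals (hm' _ _ hIc) (hm' _ _ hI2)]
        have : ∫ s in a..b, β n (s - d) * w s = 0 := by
          apply integral_zero_ae
          refine Eventually.of_forall fun x hx => ?_
          rw [uIoc_of_le (by linarith)] at hx
          rw [hβs, zero_mul]
          intro h; linarith [h.1, hx.2]
        rw [this, zero_add]
        have := integral_comp_add_right (a := a) (b := a + δ) (fun s => β n (s - d) * w s) d
        have e1 : a + d = b := by rw [hd]; ring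
        have e2 : a + δ + d = b + δ := by rw [hd]; ring
        rw [e1, e2] at this
        rw [← this]
        simp
      have : ∫ s in a..(b + δ), ζ s * w s =
          (∫ s in a..(b + δ), β n s * w s) - ∫ s in a..(b + δ), β n (s - d) * w s := by
        rw [← integral_sub (hm _ _ hIall) (hm' _ _ hIall)]
        apply integral_congr
        intro s _
        show (β n s - β n (s - d)) * w s = _
        ring
      rw [this, s1, s2, ← integral_sub (hm _ _ hI1)
        (hI3.continuousOn_mul (hβc n).continuousOn)] at hz
      simpa only [mul_sub] using hz
    have hlim : Tendsto (fun n => ∫ s in a..(a + δ), β n s * (w s - w (s + d))) atTop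
        (nhds (∫ s in a..(a + δ), (w s - w (s + d)))) := by
      apply intervalIntegral.tendsto_integral_filter_of_dominated_convergence
        (fun s => ‖w s - w (s + d)‖)
      · refine Eventually.of_forall fun n => ?_
        exact (hD.continuousOn_mul (hβc n).continuousOn).def'.aestronglyMeasurable
      · refine Eventually.of_forall fun n => Eventually.of_forall fun s _ => ?_
        rw [norm_mul, Real.norm_of_nonneg (hβ0 n s)]
        exact mul_le_of_le_one_left (norm_nonneg _) (hβ1 n s)
      · exact hD.norm
      · have : ∀ᵐ s : ℝ, s ≠ a + δ := by simp [ae_iff]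
        filter_upwards [this] with s hs hs2
        rw [uIoc_of_le (by linarith)] at hs2
        have := (hβlim s ⟨hs2.1, lt_of_le_of_ne hs2.2 hs⟩).mul_const (w s - w (s + d))
        simpa using this
    have hle := le_of_tendsto hlim (Eventually.of_forall hn)
    rw [integral_sub hI1 hI3] at hle
    have t1 : ∫ s in a..(a + δ), w s = W (a + δ) - W a := by
      apply integral_eq_sub_of_hasDerivAt _ hI1
      intro s hs
      rw [uIcc_of_le (by linarith)] at hs
      exact hW s ⟨by linarith [ha.1, hs.1], by linarith [hs.2]⟩
    have t2 : ∫ s in a..(a + δ), w (s + d) = W (b + δ) - W b := by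
      rw [integral_comp_add_right (fun s => w s) d]
      have e1 : a + d = b := by rw [hd]; ring
      have e2 : a + δ + d = b + δ := by rw [hd]; ring
      rw [e1, e2]
      apply integral_eq_sub_of_hasDerivAt _ hI2
      intro s hs
      rw [uIcc_of_le (by linarith)] at hs
      exact hW s ⟨by linarith [hb.1, hs.1], by linarith [hs.2]⟩
    rw [t1, t2] at hle
    linarith
  -- limit
  have l1 := (hW a ha).tendsto_slope_zero_right
  have l2 := (hW b hb).tendsto_slope_zero_right
  refine le_of_tendsto_of_tendsto l1 l2 ?_
  have hp : 0 < min (1 - b) (b - a) := lt_min (by linarith [hb.2]) (by linarith)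
  filter_upwards [Ioo_mem_nhdsGT hp] with δ hδ
  have := key δ hδ.1 (by linarith [hδ.2.trans_le (min_le_left _ _)])
    (by linarith [hδ.2.trans_le (min_le_right _ _)])
  simp only [smul_eq_mul]
  exact mul_le_mul_of_nonneg_left this (inv_nonneg.2 hδ.1.le)

/-- Reparametrization of an admissible path by a `C¹` diffeomorphism. -/
lemma reparam {α h : ℝ} {U : E2 → ℝ} {q : E2} {u : ℝ → E2} (hu : HcollQ α h U q u)
    {p : ℝ → ℝ} (hp : Continuous p) {c : ℝ} (hc : 0 < c) (hpc : ∀ s, c ≤ p s)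
    (hp1 : ∫ s in (0:ℝ)..1, p s = 1) :
    ∃ v, HcollQ α h U q v ∧
      (∫ s in (0:ℝ)..1, ‖deriv v s‖ ^ 2) = (∫ s in (0:ℝ)..1, ‖deriv u s‖ ^ 2 / p s) ∧
      (∫ s in (0:ℝ)..1, (h + Vpot α U (v s))) =
        (∫ s in (0:ℝ)..1, (h + Vpot α U (u s)) * p s) := by
  obtain ⟨hcont, hdiff, hu0, hu1, hball, hne, hI1, hI2⟩ := hu
  let ψ : ℝ → ℝ := fun s => ∫ x in (0:ℝ)..s, p x
  have hpi : ∀ x y, IntervalIntegrable p volume x y := fun x y => hp.intervalIntegrable x y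
  have hpp : ∀ s, 0 < p s := fun s => hc.trans_le (hpc s)
  have hψd : ∀ s, HasDerivAt ψ (p s) s := fun s =>
    integral_hasDerivAt_right (hpi _ _) (hp.stronglyMeasurableAtFilter _ _) hp.continuousAt
  have hψ0 : ψ 0 = 0 := integral_same
  have hψ1 : ψ 1 = 1 := hp1
  have hmono : StrictMono ψ := strictMono_of_hasDerivAt_pos hψd hpp
  have hψc : Continuous ψ := continuous_iff_continuousAt.2 fun s => (hψd s).continuousAt
  have himg : ψ '' Ioo 0 1 = Ioo 0 1 := by
    apply Subset.antisymm
    · rintro _ ⟨s, hs, rfl⟩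
      exact ⟨hψ0 ▸ hmono hs.1, hψ1 ▸ hmono hs.2⟩
    · have := intermediate_value_Ioo (zero_le_one (α := ℝ)) hψc.continuousOn
      rwa [hψ0, hψ1] at this
  have himg' : ψ '' Icc 0 1 = Icc 0 1 := by
    apply Subset.antisymm
    · rintro _ ⟨s, hs, rfl⟩
      exact ⟨hψ0 ▸ hmono.monotone hs.1, hψ1 ▸ hmono.monotone hs.2⟩
    · have := intermediate_value_Icc (zero_le_one (α := ℝ)) hψc.continuousOn
      rwa [hψ0, hψ1] at this
  have hsurj : Function.Surjective ψ := by
    apply hψc.surjective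
    · have hg : ∀ s, 0 ≤ s → c * s ≤ ψ s := by
        intro s hs
        have := integral_mono_on hs (continuous_const.intervalIntegrable (μ := volume) 0 s)
          (hpi 0 s) (fun x _ => hpc x)
        simpa [mul_comm] using this
      apply tendsto_atTop_mono' atTop _ (tendsto_id.const_mul_atTop hc)
      filter_upwards [eventually_ge_atTop 0] with s hs using hg s hs
    · have hg : ∀ s, s ≤ 0 → ψ s ≤ c * s := by
        intro s hs
        have := integral_mono_on hs (continuous_const.intervalIntegrable (μ := volume) s 0)
          (hpi s 0) (fun x _ => hpc x)
        have e : ψ s = -∫ x in s..0, p x := integral_symm _ _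
        rw [e]
        simp at this
        linarith
      apply tendsto_atBot_mono' atBot _ (tendsto_id.const_mul_atBot hc)
      filter_upwards [eventually_le_atBot 0] with s hs using hg s hs
  let e := hmono.orderIsoOfSurjective ψ hsurj
  let χ : ℝ → ℝ := e.symm
  have hχψ : ∀ s, χ (ψ s) = s := fun s => e.symm_apply_apply s
  have hψχ : ∀ s, ψ (χ s) = s := fun s => e.apply_symm_apply s
  have hχc : Continuous χ := e.symm.continuous
  have hχd : ∀ s, HasDerivAt χ (p (χ s))⁻¹ s := fun s =>
    HasDerivAt.of_local_left_inverse hχc.continuousAt (hψd _) (hpp _).ne'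
      (Eventually.of_forall hψχ)
  have hχI : ∀ s ∈ Ioo (0:ℝ) 1, χ s ∈ Ioo (0:ℝ) 1 := by
    intro s hs
    rw [← himg] at hs
    obtain ⟨t, ht, rfl⟩ := hs
    rwa [hχψ]
  have hχI' : ∀ s ∈ Icc (0:ℝ) 1, χ s ∈ Icc (0:ℝ) 1 := by
    intro s hs
    rw [← himg'] at hs
    obtain ⟨t, ht, rfl⟩ := hs
    rwa [hχψ]
  have hvd : ∀ s ∈ Ioo (0:ℝ) 1, HasDerivAt (u ∘ χ) ((p (χ s))⁻¹ • deriv u (χ s)) s :=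
    fun s hs => (hdiff _ (hχI s hs)).hasDerivAt.scomp s (hχd s)
  -- change of variables
  have hcov : ∀ g : ℝ → ℝ, (∫ s in (0:ℝ)..1, g s) = ∫ s in (0:ℝ)..1, p s * g (ψ s) := by
    intro g
    rw [integral_of_le zero_le_one, integral_of_le zero_le_one,
      integral_Ioc_eq_integral_Ioo, integral_Ioc_eq_integral_Ioo]
    conv_lhs => rw [← himg]
    rw [integral_image_eq_integral_abs_deriv_smul measurableSet_Ioo
      (fun s _ => (hψd s).hasDerivWithinAt) hmono.injective.injOn]
    simp only [abs_of_pos (hpp _), smul_eq_mul]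
  have hcovI : ∀ g : ℝ → ℝ, IntervalIntegrable (fun s => p s * g (ψ s)) volume 0 1 →
      IntervalIntegrable g volume 0 1 := by
    intro g hg
    rw [intervalIntegrable_iff_integrableOn_Ioo_of_le zero_le_one] at hg ⊢
    rw [← himg, integrableOn_image_iff_integrableOn_abs_deriv_smul measurableSet_Ioo
      (fun s _ => (hψd s).hasDerivWithinAt) hmono.injective.injOn]
    simpa only [abs_of_pos (hpp _), smul_eq_mul] using hg
  have hderiv : ∀ s ∈ Ioo (0:ℝ) 1,
      p s * ‖deriv (u ∘ χ) (ψ s)‖ ^ 2 = ‖deriv u s‖ ^ 2 / p s := by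
    intro s hs
    have hs' : ψ s ∈ Ioo (0:ℝ) 1 := by rw [← himg]; exact mem_image_of_mem _ hs
    rw [(hvd _ hs').deriv, hχψ, norm_smul, norm_inv, Real.norm_of_nonneg (hpp s).le]
    have := (hpp s).ne'
    field_simp
  have hpinv : Continuous (fun s => (p s)⁻¹) := hp.inv₀ (fun s => (hpp s).ne')
  refine ⟨u ∘ χ, ⟨?_, ?_, ?_, ?_, ?_, ?_, ?_, ?_⟩, ?_, ?_⟩
  · exact hcont.comp hχc.continuousOn hχI'
  · exact fun s hs => (hvd s hs).differentiableAt
  · have : χ 0 = 0 := by rw [← hψ0, hχψ, hψ0]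
    simp [this, hu0]
  · have : χ 1 = 1 := by rw [← hψ1, hχψ, hψ1]
    simp [this, hu1]
  · exact fun s hs => hball _ (hχI' s hs)
  · have hN : volume {s : ℝ | ¬ (s ∈ Icc (0:ℝ) 1 → u s ≠ 0)} = 0 := ae_iff.1 hne
    have hN' := addHaar_image_eq_zero_of_differentiableOn_of_addHaar_eq_zero volume
      (f := ψ) (fun s _ => (hψd s).differentiableAt.differentiableWithinAt) hN
    rw [ae_iff]
    refine measure_mono_null ?_ hN'
    intro s hs
    refine ⟨χ s, ?_, hψχ s⟩
    simp only [mem_ofPred_eq, Classical.not_imp, not_not] at hs ⊢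
    exact ⟨hχI' s hs.1, hs.2⟩
  · apply hcovI
    have := hI1.mul_continuousOn (g := fun s => (p s)⁻¹) hpinv.continuousOn
    refine (intervalIntegrable_congr_ae ?_).2 this
    rw [uIoc_of_le zero_le_one]
    rw [← restrict_Ioo_eq_restrict_Ioc]
    filter_upwards [ae_restrict_mem measurableSet_Ioo] with s hs
    rw [hderiv s hs, div_eq_mul_inv]
  · apply hcovI
    simp only [Function.comp, hχψ]
    exact hI2.continuousOn_mul hp.continuousOn
  · rw [hcov]
    rw [integral_of_le zero_le_one, integral_of_le zero_le_one,
      integral_Ioc_eq_integral_Ioo, integral_Ioc_eq_integral_Ioo]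
    exact setIntegral_congr_fun measurableSet_Ioo hderiv
  · rw [hcov]
    simp only [Function.comp, hχψ, mul_comm]

def IsMinim (α h : ℝ) (U : E2 → ℝ) (q : E2) (u : ℝ → E2) : Prop :=
  HcollQ α h U q u ∧ ∀ v, HcollQ α h U q v → Maupertuis α h U u ≤ Maupertuis α h U v

/-- Energy identity. -/
lemma energy_ae {α h : ℝ} {U : E2 → ℝ} {q : E2} {u : ℝ → E2} (hu : IsMinim α h U q u)
    (hP : 0 < ∫ s in (0:ℝ)..1, (h + Vpot α U (u s))) :
    ∀ᵐ s, s ∈ Ioo (0:ℝ) 1 →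
      (∫ s in (0:ℝ)..1, (h + Vpot α U (u s))) * ‖deriv u s‖ ^ 2 =
      (∫ s in (0:ℝ)..1, ‖deriv u s‖ ^ 2) * (h + Vpot α U (u s)) := by
  obtain ⟨hcl, hmin⟩ := hu
  have hI1 := hcl.2.2.2.2.2.2.1
  have hI2 := hcl.2.2.2.2.2.2.2
  set P := ∫ s in (0:ℝ)..1, (h + Vpot α U (u s)) with hPdef
  set A := ∫ s in (0:ℝ)..1, ‖deriv u s‖ ^ 2 with hAdef
  -- one-sided inequality
  have key : ∀ ζ : ℝ → ℝ, Continuous ζ → (∃ C, ∀ s, |ζ s| ≤ C) →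
      0 ≤ A * (∫ s in (0:ℝ)..1, (h + Vpot α U (u s)) * ζ s) -
        P * (∫ s in (0:ℝ)..1, ‖deriv u s‖ ^ 2 * ζ s) := by
    rintro ζ hζ ⟨C, hC⟩
    have hC0 : 0 ≤ C := (abs_nonneg _).trans (hC 0)
    set P1 := ∫ s in (0:ℝ)..1, (h + Vpot α U (u s)) * ζ s with hP1
    set A1 := ∫ s in (0:ℝ)..1, ‖deriv u s‖ ^ 2 * ζ s with hA1
    set A2 := ∫ s in (0:ℝ)..1, ‖deriv u s‖ ^ 2 * ζ s ^ 2 with hA2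
    have iP1 : IntervalIntegrable (fun s => (h + Vpot α U (u s)) * ζ s) volume 0 1 :=
      hI2.mul_continuousOn hζ.continuousOn
    have iA1 : IntervalIntegrable (fun s => ‖deriv u s‖ ^ 2 * ζ s) volume 0 1 :=
      hI1.mul_continuousOn hζ.continuousOn
    have iA2 : IntervalIntegrable (fun s => ‖deriv u s‖ ^ 2 * ζ s ^ 2) volume 0 1 :=
      hI1.mul_continuousOn (hζ.pow 2).continuousOn
    apply tail_limit (b := 2 * A2 * P - A1 * P1) (c := 2 * A2 * P1)
      (ε0 := min (1 / (2 * (C + 1))) (P / (|P1| + 1)))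
      (lt_min (by positivity) (by positivity))
    intro ε hε0 hε
    have hε1 : ε * (2 * (C + 1)) < 1 := by
      have := hε.trans_le (min_le_left _ _)
      rwa [lt_div_iff₀ (by positivity)] at this
    have hε2 : ε * (|P1| + 1) < P := by
      have := hε.trans_le (min_le_right _ _)
      rwa [lt_div_iff₀ (by positivity)] at this
    have hsm : ∀ s, |ε * ζ s| ≤ 1 / 2 := by
      intro s
      rw [abs_mul, abs_of_pos hε0]
      have := mul_le_mul_of_nonneg_left (hC s) hε0.le
      nlinarith
    have hlow : ∀ s, 1 / 2 ≤ 1 + ε * ζ s := fun s => by linarith [(abs_le.1 (hsm s)).1]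
    set m := ∫ s in (0:ℝ)..1, (1 + ε * ζ s) with hm
    have hcs : Continuous (fun s => 1 + ε * ζ s) := by fun_prop
    have hm0 : 1 / 2 ≤ m := by
      have := integral_mono_on zero_le_one
        (continuous_const.intervalIntegrable (μ := volume) 0 1)
          (hcs.intervalIntegrable 0 1) (fun x _ => hlow x)
      simpa using this
    have hmpos : 0 < m := by linarith
    obtain ⟨v, hv, hv1, hv2⟩ := reparam hcl (p := fun s => (1 + ε * ζ s) / m) (by fun_prop)
      (c := 1 / 2 / m) (by positivity) (fun s => by gcongr; exact hlow s)
      (by rw [intervalIntegral.integral_div, div_self hmpos.ne'])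
    have hle := hmin v hv
    unfold Maupertuis at hle
    rw [hv1, hv2, ← hPdef, ← hAdef] at hle
    have e1 : ∫ s in (0:ℝ)..1, ‖deriv u s‖ ^ 2 / ((1 + ε * ζ s) / m) =
        m * ∫ s in (0:ℝ)..1, ‖deriv u s‖ ^ 2 / (1 + ε * ζ s) := by
      rw [← intervalIntegral.integral_const_mul]
      apply integral_congr
      intro s _
      have : 1 + ε * ζ s ≠ 0 := by linarith [hlow s]
      simp only
      field_simp
    have e2 : ∫ s in (0:ℝ)..1, (h + Vpot α U (u s)) * ((1 + ε * ζ s) / m) =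
        (P + ε * P1) / m := by
      rw [hPdef, hP1, ← intervalIntegral.integral_const_mul,
        ← intervalIntegral.integral_add hI2 (iP1.const_mul ε), ← intervalIntegral.integral_div]
      apply integral_congr
      intro s _
      simp only
      ring
    have e3 : ∫ s in (0:ℝ)..1, ‖deriv u s‖ ^ 2 / (1 + ε * ζ s) ≤
        A - ε * A1 + 2 * ε ^ 2 * A2 := by
      rw [hAdef, hA1, hA2, ← intervalIntegral.integral_const_mul,
        ← intervalIntegral.integral_const_mul,
        ← intervalIntegral.integral_sub hI1 (iA1.const_mul ε),
        ← intervalIntegral.integral_add (hI1.sub (iA1.const_mul ε)) (iA2.const_mul _)]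
      apply integral_mono_on zero_le_one
      · simp only [div_eq_mul_inv]
        exact hI1.mul_continuousOn (hcs.inv₀ (fun s => by linarith [hlow s])).continuousOn
      · exact (hI1.sub (iA1.const_mul ε)).add (iA2.const_mul _)
      · intro s _
        have h1 : 1 / (1 + ε * ζ s) ≤ 1 - ε * ζ s + 2 * (ε * ζ s) ^ 2 := by
          rw [div_le_iff₀ (by linarith [hlow s])]
          have := (abs_le.1 (hsm s))
          nlinarith [mul_nonneg (sq_nonneg (ε * ζ s)) (by linarith : 0 ≤ 1 + 2 * (ε * ζ s))]
        have := mul_le_mul_of_nonneg_left h1 (sq_nonneg ‖deriv u s‖)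
        calc _ = ‖deriv u s‖ ^ 2 * (1 / (1 + ε * ζ s)) := by ring
          _ ≤ _ := this
          _ = _ := by ring
    have hPp : 0 < P + ε * P1 := by
      have := mul_le_mul_of_nonneg_left (neg_abs_le P1) hε0.le
      nlinarith
    rw [e1, e2] at hle
    have e4 : 1 / 2 * (m * ∫ s in (0:ℝ)..1, ‖deriv u s‖ ^ 2 / (1 + ε * ζ s)) *
        ((P + ε * P1) / m) =
        1 / 2 * (∫ s in (0:ℝ)..1, ‖deriv u s‖ ^ 2 / (1 + ε * ζ s)) * (P + ε * P1) := by
      field_simp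
    rw [e4] at hle
    have h5 := mul_le_mul_of_nonneg_right e3 hPp.le
    nlinarith
  have keyeq : ∀ ζ : ℝ → ℝ, Continuous ζ → (∃ C, ∀ s, |ζ s| ≤ C) →
      A * (∫ s in (0:ℝ)..1, (h + Vpot α U (u s)) * ζ s) -
        P * (∫ s in (0:ℝ)..1, ‖deriv u s‖ ^ 2 * ζ s) = 0 := by
    intro ζ hζ hC
    apply le_antisymm _ (key ζ hζ hC)
    have := key (fun s => - ζ s) hζ.neg (by simpa using hC)
    simp only [mul_neg, intervalIntegral.integral_neg] at this
    linarith
  have hloc : IntegrableOn (fun s => P * ‖deriv u s‖ ^ 2 - A * (h + Vpot α U (u s)))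
      (Ioo (0:ℝ) 1) := by
    rw [← intervalIntegrable_iff_integrableOn_Ioo_of_le zero_le_one]
    exact (hI1.const_mul P).sub (hI2.const_mul A)
  have := isOpen_Ioo.ae_eq_zero_of_integral_contDiff_smul_eq_zero (U := Ioo (0:ℝ) 1)
    (μ := volume) hloc.locallyIntegrableOn (by
      intro g hg hgc hgs
      obtain ⟨C, hC⟩ := hgc.exists_bound_of_continuous hg.continuous
      have h0 := keyeq g hg.continuous ⟨C, hC⟩
      have iP1 : IntervalIntegrable (fun s => (h + Vpot α U (u s)) * g s) volume 0 1 :=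
        hI2.mul_continuousOn hg.continuous.continuousOn
      have iA1 : IntervalIntegrable (fun s => ‖deriv u s‖ ^ 2 * g s) volume 0 1 :=
        hI1.mul_continuousOn hg.continuous.continuousOn
      have hz : ∀ s, s ∉ Ioo (0:ℝ) 1 →
          g s • (P * ‖deriv u s‖ ^ 2 - A * (h + Vpot α U (u s))) = 0 := by
        intro s hs
        have : g s = 0 := by
          by_contra hne
          exact hs (hgs (subset_tsupport g hne))
        simp [this]
      rw [← setIntegral_eq_integral_of_forall_compl_eq_zero hz,
        ← integral_Ioc_eq_integral_Ioo, ← integral_of_le zero_le_one]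
      rw [← intervalIntegral.integral_const_mul, ← intervalIntegral.integral_const_mul,
        ← intervalIntegral.integral_sub (iP1.const_mul A) (iA1.const_mul P)] at h0
      rw [← neg_eq_zero, ← intervalIntegral.integral_neg]
      refine Eq.trans ?_ h0
      apply integral_congr
      intro s _
      simp only [smul_eq_mul]
      ring)
  filter_upwards [this] with s hs hs'
  linarith [hs hs']

lemma congr_Ioo_integrable {f g : ℝ → ℝ} (h : ∀ s ∈ Ioo (0:ℝ) 1, f s = g s)
    (hg : IntervalIntegrable g volume 0 1) : IntervalIntegrable f volume 0 1 := by
  rw [intervalIntegrable_iff_integrableOn_Ioo_of_le zero_le_one] at hg ⊢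
  exact hg.congr_fun (fun s hs => (h s hs).symm) measurableSet_Ioo

lemma congr_Ioo_integral {f g : ℝ → ℝ} (h : ∀ s ∈ Ioo (0:ℝ) 1, f s = g s) :
    (∫ s in (0:ℝ)..1, f s) = ∫ s in (0:ℝ)..1, g s := by
  rw [integral_of_le zero_le_one, integral_of_le zero_le_one,
      integral_Ioc_eq_integral_Ioo, integral_Ioc_eq_integral_Ioo]
  exact setIntegral_congr_fun measurableSet_Ioo h

lemma mono_Ioo_integral {f g : ℝ → ℝ} (hf : IntervalIntegrable f volume 0 1)
    (hg : IntervalIntegrable g volume 0 1) (h : ∀ s ∈ Ioo (0:ℝ) 1, f s ≤ g s) :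
    (∫ s in (0:ℝ)..1, f s) ≤ ∫ s in (0:ℝ)..1, g s :=
  integral_mono_on_of_le_Ioo zero_le_one hf hg h

lemma deriv_int {u : ℝ → E2} (h : IntervalIntegrable (fun s => ‖deriv u s‖ ^ 2) volume 0 1) :
    IntervalIntegrable (deriv u) volume 0 1 := by
  refine IntervalIntegrable.mono_fun' (g := fun s => 1 + ‖deriv u s‖ ^ 2)
    ((continuous_const.intervalIntegrable 0 1).add h)
    (stronglyMeasurable_deriv u).aestronglyMeasurable ?_
  refine Eventually.of_forall fun s => ?_
  simp only
  nlinarith [sq_nonneg (‖deriv u s‖ - 1)]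

lemma inner_deriv_int {α h : ℝ} {U : E2 → ℝ} {q : E2} {u : ℝ → E2} (hu : HcollQ α h U q u) :
    IntervalIntegrable (fun s => inner ℝ (u s) (deriv u s)) volume 0 1 := by
  have h1 := (deriv_int hu.2.2.2.2.2.2.1).norm
  refine IntervalIntegrable.mono_fun' (h1.const_mul ‖q‖) ?_ ?_
  · refine AEStronglyMeasurable.inner ?_ (stronglyMeasurable_deriv u).aestronglyMeasurable
    rw [uIoc_of_le zero_le_one]
    exact (hu.1.mono Ioc_subset_Icc_self).aestronglyMeasurable measurableSet_Ioc
  · rw [uIoc_of_le zero_le_one]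
    filter_upwards [ae_restrict_mem measurableSet_Ioc] with s hs
    refine (norm_inner_le_norm _ _).trans ?_
    exact mul_le_mul_of_nonneg_right (hu.2.2.2.2.1 s (Ioc_subset_Icc_self hs)) (norm_nonneg _)

lemma Vpot_int {α h : ℝ} {U : E2 → ℝ} {q : E2} {u : ℝ → E2} (hu : HcollQ α h U q u) :
    IntervalIntegrable (fun s => Vpot α U (u s)) volume 0 1 := by
  have := hu.2.2.2.2.2.2.2.sub (continuous_const (y := h).intervalIntegrable (μ := volume) 0 1)
  simpa using this

lemma rpow_neg_bound {α x : ℝ} (hα : α ∈ Ioo (0:ℝ) 2) (h0 : 0 ≤ x) (h1 : x ≤ 1 / 2) :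
    (1 - x) ^ (-α) ≤ 1 + α * x + 8 * x ^ 2 := by
  have hx : 0 < 1 - x := by linarith
  set y := x + 2 * x ^ 2 with hy
  have hy0 : 0 ≤ y := by positivity
  have hinv : (1 - x)⁻¹ ≤ 1 + y := by
    rw [inv_le_iff_one_le_mul₀ hx, hy]
    nlinarith [mul_nonneg (sq_nonneg x) (by linarith : 0 ≤ 1 - 2 * x)]
  have e : (1 - x) ^ (-α) = (((1 - x)⁻¹) ^ (α / 2)) ^ 2 := by
    rw [← Real.rpow_natCast, ← Real.rpow_mul (by positivity), Real.inv_rpow hx.le,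
      ← Real.rpow_neg hx.le]
    congr 1; push_cast; ring
  have hb : ((1 - x)⁻¹) ^ (α / 2) ≤ 1 + α / 2 * y := by
    refine (Real.rpow_le_rpow (by positivity) hinv (by linarith [hα.1])).trans ?_
    exact rpow_one_add_le_one_add_mul_self (by linarith) (by linarith [hα.1])
      (by linarith [hα.2])
  rw [e]
  have h0' : 0 ≤ ((1 - x)⁻¹) ^ (α / 2) := by positivity
  have hy2 : y ≤ 2 * x := by rw [hy]; nlinarith
  have hsq : y ^ 2 ≤ (2 * x) ^ 2 := pow_le_pow_left₀ hy0 hy2 2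
  have hα4 : α ^ 2 ≤ 4 := by nlinarith [hα.1, hα.2]
  calc _ ≤ (1 + α / 2 * y) ^ 2 := pow_le_pow_left₀ h0' hb 2
    _ = 1 + α * y + α ^ 2 / 4 * y ^ 2 := by ring
    _ ≤ 1 + α * y + 1 * (2 * x) ^ 2 := by gcongr; linarith
    _ = 1 + α * x + 2 * α * x ^ 2 + 4 * x ^ 2 := by rw [hy]; ring
    _ ≤ _ := by nlinarith [sq_nonneg x, hα.2]

lemma inward_variation {α h Umin : ℝ} (hα : α ∈ Ioo (0:ℝ) 2) {U : E2 → ℝ}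
    (hUmin : ∀ s : E2, ‖s‖ = 1 → Umin ≤ U s) (hU0 : 0 < Umin) {q : E2} {u : ℝ → E2}
    (hu : IsMinim α h U q u)
    (hG : ∀ x : E2, x ≠ 0 → ‖x‖ ≤ ‖q‖ → 0 ≤ 2 * h + (2 - α) * Vpot α U x)
    (hP : 0 < ∫ s in (0:ℝ)..1, (h + Vpot α U (u s)))
    {η ζ : ℝ → ℝ} (hζ : Continuous ζ) (hη : ∀ s, HasDerivAt η (ζ s) s) (hη0 : ∀ s, 0 ≤ η s)
    {C : ℝ} (hηC : ∀ s, η s ≤ C) (hz : η 0 = 0) :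
    ∫ s in (0:ℝ)..1, ζ s * inner ℝ (u s) (deriv u s) ≤ 0 := by
  have hen := energy_ae hu hP
  obtain ⟨hcl, hmin⟩ := hu
  have hJ := inner_deriv_int hcl
  have hV := Vpot_int hcl
  obtain ⟨hcont, hdiff, hu0, hu1, hball, hne, hI1, hI2⟩ := hcl
  have hηc : Continuous η := continuous_iff_continuousAt.2 fun s => (hη s).continuousAt
  have hC0 : 0 ≤ C := (hη0 0).trans (hηC 0)
  set P := ∫ s in (0:ℝ)..1, (h + Vpot α U (u s)) with hPdef
  set A := ∫ s in (0:ℝ)..1, ‖deriv u s‖ ^ 2 with hAdef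
  have hV0 : ∀ x, 0 ≤ Vpot α U x := Vpot_nonneg hα.1 hUmin hU0
  have hA0 : 0 ≤ A := integral_nonneg zero_le_one (fun s _ => sq_nonneg _)
  set B0 := ∫ s in (0:ℝ)..1, η s * ‖deriv u s‖ ^ 2 with hB0
  set B1 := ∫ s in (0:ℝ)..1, ζ s * inner ℝ (u s) (deriv u s) with hB1
  have iB0 : IntervalIntegrable (fun s => η s * ‖deriv u s‖ ^ 2) volume 0 1 :=
    hI1.continuousOn_mul hηc.continuousOn
  have iB1 : IntervalIntegrable (fun s => ζ s * inner ℝ (u s) (deriv u s)) volume 0 1 :=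
    hJ.continuousOn_mul hζ.continuousOn
  have hucc : ContinuousOn u (uIcc 0 1) := by rwa [uIcc_of_le zero_le_one]
  let g2 : ℝ → ℝ := fun s => η s ^ 2 * ‖deriv u s‖ ^ 2 +
    (2 * η s * ζ s) * inner ℝ (u s) (deriv u s) + ζ s ^ 2 * ‖u s‖ ^ 2
  have iB2 : IntervalIntegrable g2 volume 0 1 := by
    refine ((hI1.continuousOn_mul (hηc.pow 2).continuousOn).add
      (hJ.continuousOn_mul (by fun_prop))).add (ContinuousOn.intervalIntegrable ?_)
    exact (hζ.pow 2).continuousOn.mul (hucc.norm.pow 2)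
  set B2 := ∫ s in (0:ℝ)..1, g2 s with hB2
  set Q1 := ∫ s in (0:ℝ)..1, η s * Vpot α U (u s) with hQ1
  set Q2 := ∫ s in (0:ℝ)..1, η s ^ 2 * Vpot α U (u s) with hQ2
  have iQ1 : IntervalIntegrable (fun s => η s * Vpot α U (u s)) volume 0 1 :=
    hV.continuousOn_mul hηc.continuousOn
  have iQ2 : IntervalIntegrable (fun s => η s ^ 2 * Vpot α U (u s)) volume 0 1 :=
    hV.continuousOn_mul (hηc.pow 2).continuousOn
  have main : 0 ≤ A * (α * Q1) - 2 * (B0 + B1) * P := by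
    apply tail_limit (b := A * (8 * Q2) - 2 * (B0 + B1) * (α * Q1) + B2 * P)
      (c := -2 * (B0 + B1) * (8 * Q2) + B2 * (α * Q1) + B2 * 8 * Q2 * 0 +
        |B2 * 8 * Q2|)
      (ε0 := min (1 / (2 * (C + 1))) 1) (lt_min (by positivity) one_pos)
    intro ε hε0 hε
    have hε1 : ε * (2 * (C + 1)) < 1 := by
      have := hε.trans_le (min_le_left _ _)
      rwa [lt_div_iff₀ (by positivity)] at this
    have hε2 : ε < 1 := hε.trans_le (min_le_right _ _)
    have hsm : ∀ s, ε * η s ≤ 1 / 2 := by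
      intro s
      have := mul_le_mul_of_nonneg_left (hηC s) hε0.le
      nlinarith
    have hsm0 : ∀ s, 0 ≤ ε * η s := fun s => mul_nonneg hε0.le (hη0 s)
    have hpos : ∀ s, 0 < 1 - ε * η s := fun s => by linarith [hsm s]
    let v : ℝ → E2 := fun s => (1 - ε * η s) • u s
    have hvd : ∀ s ∈ Ioo (0:ℝ) 1,
        HasDerivAt v ((1 - ε * η s) • deriv u s + (-(ε * ζ s)) • u s) s := by
      intro s hs
      exact (((hη s).const_mul ε).const_sub 1).smul (hdiff s hs).hasDerivAt
    have hvn : ∀ s ∈ Ioo (0:ℝ) 1, ‖deriv v s‖ ^ 2 =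
        ‖deriv u s‖ ^ 2 - (2 * ε) * (η s * ‖deriv u s‖ ^ 2 + ζ s * inner ℝ (u s) (deriv u s))
          + ε ^ 2 * g2 s := by
      intro s hs
      rw [(hvd s hs).deriv, norm_add_sq_real, norm_smul, norm_smul, mul_pow, mul_pow,
        Real.norm_eq_abs, Real.norm_eq_abs, sq_abs, sq_abs, inner_smul_left, inner_smul_right,
        real_inner_comm]
      simp only [g2, conj_trivial]
      ring
    have iv1 := (hI1.sub ((iB0.add iB1).const_mul (2 * ε))).add (iB2.const_mul (ε ^ 2))
    have hvV : ∀ s, Vpot α U (v s) = (1 - ε * η s) ^ (-α) * Vpot α U (u s) :=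
      fun s => Vpot_smul α U (hpos s) _
    have hcr : Continuous (fun s => (1 - ε * η s) ^ (-α)) := by
      apply Continuous.rpow_const (by fun_prop)
      intro s; left; exact (hpos s).ne'
    have iv2 : IntervalIntegrable (fun s => h + Vpot α U (v s)) volume 0 1 := by
      simp only [hvV]
      exact (continuous_const.intervalIntegrable 0 1).add (hV.continuousOn_mul hcr.continuousOn)
    have hv : HcollQ α h U q v := by
      refine ⟨?_, fun s hs => (hvd s hs).differentiableAt, ?_, ?_, ?_, ?_, ?_, iv2⟩
      · exact (by fun_prop : Continuous fun s => 1 - ε * η s).continuousOn.smul hcont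
      · simp [v, hz, hu0]
      · simp [v, hu1]
      · intro s hs
        simp only [v]
        rw [norm_smul, Real.norm_of_nonneg (hpos s).le]
        exact (mul_le_of_le_one_left (norm_nonneg _) (by linarith [hsm0 s])).trans (hball s hs)
      · filter_upwards [hne] with s hs hs2
        exact smul_ne_zero (hpos s).ne' (hs hs2)
      · exact congr_Ioo_integrable hvn iv1
    have hle := hmin v hv
    unfold Maupertuis at hle
    rw [← hPdef, ← hAdef] at hle
    have e1 : ∫ s in (0:ℝ)..1, ‖deriv v s‖ ^ 2 = A - 2 * ε * (B0 + B1) + ε ^ 2 * B2 := by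
      rw [congr_Ioo_integral hvn, intervalIntegral.integral_add
        (hI1.sub ((iB0.add iB1).const_mul (2 * ε))) (iB2.const_mul (ε ^ 2)),
        intervalIntegral.integral_sub hI1 ((iB0.add iB1).const_mul (2 * ε)),
        intervalIntegral.integral_const_mul, intervalIntegral.integral_const_mul,
        intervalIntegral.integral_add iB0 iB1]
    have e2 : ∫ s in (0:ℝ)..1, (h + Vpot α U (v s)) ≤ P + ε * α * Q1 + 8 * ε ^ 2 * Q2 := by
      rw [hPdef, hQ1, hQ2, ← intervalIntegral.integral_const_mul,
        ← intervalIntegral.integral_const_mul,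
        ← intervalIntegral.integral_add hI2 (iQ1.const_mul _),
        ← intervalIntegral.integral_add (hI2.add (iQ1.const_mul _)) (iQ2.const_mul _)]
      apply mono_Ioo_integral iv2 ((hI2.add (iQ1.const_mul _)).add (iQ2.const_mul _))
      intro s hs
      rw [hvV]
      have := mul_le_mul_of_nonneg_right (rpow_neg_bound hα (hsm0 s) (hsm s)) (hV0 (u s))
      linarith
    have hA' : 0 ≤ ∫ s in (0:ℝ)..1, ‖deriv v s‖ ^ 2 :=
      integral_nonneg zero_le_one (fun s _ => sq_nonneg _)
    have h5 := mul_le_mul_of_nonneg_left e2 hA'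
    rw [e1] at h5 hle
    have h6 : ε ^ 4 * (B2 * 8 * Q2) ≤ ε ^ 3 * |B2 * 8 * Q2| := by
      have t1 : ε ^ 4 * (B2 * 8 * Q2) ≤ ε ^ 4 * |B2 * 8 * Q2| :=
        mul_le_mul_of_nonneg_left (le_abs_self _) (by positivity)
      have t2 : ε ^ 4 ≤ ε ^ 3 := pow_le_pow_of_le_one hε0.le hε2.le (by norm_num)
      exact t1.trans (mul_le_mul_of_nonneg_right t2 (abs_nonneg _))
    nlinarith
  -- use the energy identity
  have hB0' : P * B0 = A * (∫ s in (0:ℝ)..1, η s * (h + Vpot α U (u s))) := by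
    rw [hB0, ← intervalIntegral.integral_const_mul, ← intervalIntegral.integral_const_mul]
    apply intervalIntegral.integral_congr_ae
    have h1 : ∀ᵐ s : ℝ, s ≠ 1 := by simp [ae_iff]
    filter_upwards [hen, h1] with s hs hs1 hs2
    rw [uIoc_of_le zero_le_one] at hs2
    have := hs ⟨hs2.1, lt_of_le_of_ne hs2.2 hs1⟩
    linear_combination η s * this
  have iH : IntervalIntegrable (fun s => η s * (h + Vpot α U (u s))) volume 0 1 :=
    hI2.continuousOn_mul hηc.continuousOn
  have hfin : 0 ≤ 2 * (∫ s in (0:ℝ)..1, η s * (h + Vpot α U (u s))) - α * Q1 := by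
    rw [hQ1, ← intervalIntegral.integral_const_mul, ← intervalIntegral.integral_const_mul,
      ← intervalIntegral.integral_sub (iH.const_mul _) (iQ1.const_mul _)]
    apply integral_nonneg_of_ae_restrict zero_le_one
    rw [EventuallyLE, ae_restrict_iff' measurableSet_Icc]
    filter_upwards [hne] with s hs hs2
    have := mul_nonneg (hη0 s) (hG (u s) (hs hs2) (hball s hs2))
    simp only [Pi.zero_apply]
    linarith
  have h7 := mul_nonneg hA0 hfin
  have h8 : P * B1 ≤ 0 := by nlinarith
  by_contra hcon
  push Not at hcon
  nlinarith [mul_pos hP hcon]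

lemma sq_norm_convex {α h Umin : ℝ} (hα : α ∈ Ioo (0:ℝ) 2) {U : E2 → ℝ}
    (hUmin : ∀ s : E2, ‖s‖ = 1 → Umin ≤ U s) (hU0 : 0 < Umin) {q : E2} {u : ℝ → E2}
    (hu : IsMinim α h U q u)
    (hG : ∀ x : E2, x ≠ 0 → ‖x‖ ≤ ‖q‖ → 0 ≤ 2 * h + (2 - α) * Vpot α U x)
    (hP : 0 < ∫ s in (0:ℝ)..1, (h + Vpot α U (u s))) :
    ConvexOn ℝ (Icc 0 1) (fun s => ‖u s‖ ^ 2 / 2) := by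
  have hder : ∀ s ∈ Ioo (0:ℝ) 1,
      HasDerivAt (fun s => ‖u s‖ ^ 2 / 2) (inner ℝ (u s) (deriv u s)) s := by
    intro s hs
    have := ((hu.1.2.1 s hs).hasDerivAt.norm_sq).div_const 2
    simpa using this
  have hJ := inner_deriv_int hu.1
  have hmono : MonotoneOn (fun s => inner ℝ (u s) (deriv u s)) (Ioo 0 1) := by
    apply weak_monotone hder
    · intro a b ha hab hb
      apply hJ.mono_set
      rw [uIcc_of_le hab.le, uIcc_of_le zero_le_one]
      exact Icc_subset_Icc ha.le hb.le
    · intro a b ha hab hb η ζ hζ hη hη0 hηs hζs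
      have hηc : Continuous η := continuous_iff_continuousAt.2 fun s => (hη s).continuousAt
      obtain ⟨C, hC⟩ := (isCompact_Icc (a := a) (b := b)).exists_bound_of_continuousOn
        hηc.continuousOn
      have hC' : ∀ s, η s ≤ max C 0 := by
        intro s
        by_cases hs : s ∈ Ioo a b
        · exact (le_abs_self _).trans ((hC s (Ioo_subset_Icc_self hs)).trans (le_max_left _ _))
        · rw [hηs s hs]; exact le_max_right _ _
      have := inward_variation hα hUmin hU0 hu hG hP hζ hη hη0 hC'
        (hηs 0 (fun h => by linarith [h.1]))
      have e : ∫ s in a..b, ζ s * inner ℝ (u s) (deriv u s) =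
          ∫ s in (0:ℝ)..1, ζ s * inner ℝ (u s) (deriv u s) := by
        rw [integral_of_le hab.le, integral_of_le zero_le_one]
        refine (setIntegral_eq_of_subset_of_forall_sdiff_eq_zero measurableSet_Ioc
          (Ioc_subset_Ioc ha.le hb.le) ?_).symm
        intro s hs
        rw [hζs, zero_mul]
        intro h
        exact hs.2 (Ioo_subset_Ioc_self h)
      rw [e]; exact this
  apply MonotoneOn.convexOn_of_deriv (convex_Icc 0 1)
  · exact (hu.1.1.norm.pow 2).div_const 2
  · rw [interior_Icc]
    exact fun s hs => (hder s hs).differentiableAt.differentiableWithinAt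
  · rw [interior_Icc]
    exact hmono.congr (fun s hs => (hder s hs).deriv.symm)

lemma norm_bounds {α h Umin : ℝ} (hα : α ∈ Ioo (0:ℝ) 2) {U : E2 → ℝ}
    (hUmin : ∀ s : E2, ‖s‖ = 1 → Umin ≤ U s) (hU0 : 0 < Umin) {q : E2} {u : ℝ → E2}
    (hu : IsMinim α h U q u)
    (hG : ∀ x : E2, x ≠ 0 → ‖x‖ ≤ ‖q‖ → 0 ≤ 2 * h + (2 - α) * Vpot α U x)
    (hP : 0 < ∫ s in (0:ℝ)..1, (h + Vpot α U (u s))) (hq : q ≠ 0) :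
    ∀ s ∈ Ioo (0:ℝ) 1, u s ≠ 0 ∧ ‖u s‖ < ‖q‖ := by
  have hconv := sq_norm_convex hα hUmin hU0 hu hG hP
  obtain ⟨hcont, hdiff, hu0, hu1, hball, hne, hI1, hI2⟩ := hu.1
  have hq' : 0 < ‖q‖ := norm_pos_iff.2 hq
  intro t ht
  constructor
  · intro h0
    -- the function vanishes on `[t,1]`
    have hzero : ∀ s ∈ Ioo t 1, u s = 0 := by
      intro s hs
      have h1 := hconv.le_max_of_mem_Icc (x := t) (y := 1) (z := s) ⟨ht.1.le, ht.2.le⟩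
        ⟨zero_le_one, le_rfl⟩ ⟨hs.1.le, hs.2.le⟩
      simp only [h0, hu1, norm_zero, max_self] at h1
      have : ‖u s‖ ^ 2 = 0 := le_antisymm (by linarith) (sq_nonneg _)
      exact norm_eq_zero.1 (pow_eq_zero_iff (by norm_num) |>.1 this)
    have hnull : volume (Ioo t 1) = 0 := by
      refine measure_mono_null ?_ (ae_iff.1 hne)
      intro s hs
      simp only [mem_ofPred_eq, Classical.not_imp, not_not]
      exact ⟨⟨by linarith [ht.1, hs.1], hs.2.le⟩, hzero s hs⟩
    rw [Real.volume_Ioo, ENNReal.ofReal_eq_zero] at hnull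
    linarith [ht.2]
  · have h1 := hconv.2 (show (0:ℝ) ∈ Icc (0:ℝ) 1 from ⟨le_rfl, zero_le_one⟩)
      (show (1:ℝ) ∈ Icc (0:ℝ) 1 from ⟨zero_le_one, le_rfl⟩)
      (show 0 ≤ 1 - t by linarith [ht.2]) ht.1.le (by ring)
    simp only [smul_eq_mul, mul_zero, mul_one, zero_add, hu0, hu1, norm_zero] at h1
    have h2 : ‖u t‖ ^ 2 < ‖q‖ ^ 2 := by nlinarith [ht.1, sq_pos_of_pos hq']
    exact lt_of_pow_lt_pow_left₀ 2 hq'.le h2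

lemma el_weak {α h : ℝ} {U : E2 → ℝ} (hUC : ContDiff ℝ 2 U) {q : E2} {u : ℝ → E2}
    (hu : IsMinim α h U q u)
    (hnb : ∀ s ∈ Ioo (0:ℝ) 1, u s ≠ 0 ∧ ‖u s‖ < ‖q‖)
    {a b : ℝ} (ha : 0 < a) (hab : a < b) (hb : b < 1)
    {η ζ : ℝ → ℝ} (hζ : Continuous ζ) (hη : ∀ s, HasDerivAt η (ζ s) s)
    (hηs : ∀ s, s ∉ Ioo a b → η s = 0) (hζs : ∀ s, s ∉ Ioo a b → ζ s = 0) (e : E2) :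
    (∫ s in (0:ℝ)..1, (h + Vpot α U (u s))) * (∫ s in a..b, ζ s * inner ℝ e (deriv u s)) +
      (∫ s in (0:ℝ)..1, ‖deriv u s‖ ^ 2) / 2 *
        (∫ s in a..b, η s * fderiv ℝ (Vpot α U) (u s) e) = 0 := by
  obtain ⟨hcl, hmin⟩ := hu
  have hV := Vpot_int hcl
  obtain ⟨hcont, hdiff, hu0, hu1, hball, hne, hI1, hI2⟩ := hcl
  have hηc : Continuous η := continuous_iff_continuousAt.2 fun s => (hη s).continuousAt
  have hsub : Icc a b ⊆ Ioo (0:ℝ) 1 := fun s hs => ⟨ha.trans_le hs.1, hs.2.trans_lt hb⟩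
  have hcab : ContinuousOn u (Icc a b) := hcont.mono (hsub.trans Ioo_subset_Icc_self)
  set P := ∫ s in (0:ℝ)..1, (h + Vpot α U (u s)) with hPdef
  set A := ∫ s in (0:ℝ)..1, ‖deriv u s‖ ^ 2 with hAdef
  -- uniform distances
  obtain ⟨d0, hd0, hd1, hd2⟩ : ∃ d0 > 0, (∀ s ∈ Icc a b, 2 * d0 ≤ ‖u s‖) ∧
      ∀ s ∈ Icc a b, ‖u s‖ ≤ ‖q‖ - d0 := by
    obtain ⟨s1, hs1, h1⟩ := isCompact_Icc.exists_isMinOn (nonempty_Icc.2 hab.le) hcab.norm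
    obtain ⟨s2, hs2, h2⟩ := isCompact_Icc.exists_isMaxOn (nonempty_Icc.2 hab.le) hcab.norm
    have p1 : 0 < ‖u s1‖ := norm_pos_iff.2 (hnb s1 (hsub hs1)).1
    have p2 := (hnb s2 (hsub hs2)).2
    refine ⟨min (‖u s1‖ / 2) (‖q‖ - ‖u s2‖), lt_min (by positivity) (by linarith), ?_, ?_⟩
    · intro s hs
      have := h1 hs
      simp only [mem_ofPred_eq] at this
      linarith [min_le_left (‖u s1‖ / 2) (‖q‖ - ‖u s2‖)]
    · intro s hs
      have := h2 hs
      simp only [mem_ofPred_eq] at this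
      linarith [min_le_right (‖u s1‖ / 2) (‖q‖ - ‖u s2‖)]
  obtain ⟨C, hC⟩ := (isCompact_Icc (a := a) (b := b)).exists_bound_of_continuousOn
        hηc.continuousOn
  have hC0 : 0 ≤ C := (norm_nonneg _).trans (hC a ⟨le_rfl, hab.le⟩)
  have hC' : ∀ s, |η s| ≤ C := by
    intro s
    by_cases hs : s ∈ Ioo a b
    · exact hC s (Ioo_subset_Icc_self hs)
    · rw [hηs s hs, abs_zero]; exact hC0
  set ε0 := d0 / ((C + 1) * (‖e‖ + 1)) with hε0
  have hεpos : 0 < ε0 := by positivity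
  have hsmall : ∀ ε, |ε| < ε0 → ∀ s, ‖(ε * η s) • e‖ ≤ d0 := by
    intro ε hε s
    rw [norm_smul, Real.norm_eq_abs, abs_mul]
    rw [hε0, lt_div_iff₀ (by positivity)] at hε
    calc |ε| * |η s| * ‖e‖ ≤ |ε| * (C + 1) * (‖e‖ + 1) := by
          gcongr
          · linarith [hC' s]
          · linarith
      _ ≤ d0 := by linarith
  let v : ℝ → ℝ → E2 := fun ε s => u s + (ε * η s) • e
  have hvlow : ∀ ε, |ε| < ε0 → ∀ s ∈ Icc a b, d0 ≤ ‖v ε s‖ := by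
    intro ε hε s hs
    have h1 := hsmall ε hε s
    have h2 := norm_sub_norm_le (u s) (-((ε * η s) • e))
    rw [norm_neg, sub_neg_eq_add] at h2
    show d0 ≤ ‖u s + (ε * η s) • e‖
    linarith [hd1 s hs]
  have hvup : ∀ ε, |ε| < ε0 → ∀ s ∈ Icc a b, ‖v ε s‖ ≤ ‖q‖ := by
    intro ε hε s hs
    have h1 := hsmall ε hε s
    have h2 := norm_add_le (u s) ((ε * η s) • e)
    show ‖u s + (ε * η s) • e‖ ≤ ‖q‖
    linarith [hd2 s hs]
  have hvne : ∀ ε, |ε| < ε0 → ∀ s ∈ Icc a b, v ε s ≠ 0 := fun ε hε s hs =>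
    norm_pos_iff.1 (hd0.trans_le (hvlow ε hε s hs))
  have hvout : ∀ ε s, s ∉ Ioo a b → v ε s = u s := by
    intro ε s hs
    simp [v, hηs s hs]
  have hvc : ∀ ε, ContinuousOn (v ε) (Icc a b) := fun ε =>
    hcab.add ((by fun_prop : Continuous fun s => (ε * η s) • e).continuousOn)
  have hVvc : ∀ ε, |ε| < ε0 → ContinuousOn (fun s => Vpot α U (v ε s)) (Icc a b) := by
    intro ε hε s hs
    exact ContinuousAt.comp_continuousWithinAt (f := v ε)
      (Vpot_continuousAt α hUC (hvne ε hε s hs)) (hvc ε s hs)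
  obtain ⟨C1, hC1, hC1b⟩ := Vpot_fderiv_bound α hUC (R := ‖q‖) hd0
  have h00 : |(0:ℝ)| < ε0 := by simpa using hεpos
  have hv0 : v 0 = u := by funext s; simp [v]
  -- derivative of potential part
  have hF := (intervalIntegral.hasDerivAt_integral_of_dominated_loc_of_deriv_le
    (μ := volume) (a := a) (b := b) (x₀ := (0:ℝ)) (s := Ioo (-ε0) ε0)
    (bound := fun _ => C1 * (C * ‖e‖))
    (F := fun ε s => Vpot α U (v ε s))
    (F' := fun ε s => fderiv ℝ (Vpot α U) (v ε s) (η s • e))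
    (Ioo_mem_nhds (by linarith) hεpos)
    (by
      filter_upwards [Ioo_mem_nhds (show -ε0 < 0 by linarith) hεpos] with ε hε
      rw [uIoc_of_le hab.le]
      exact ((hVvc ε (abs_lt.2 hε)).mono Ioc_subset_Icc_self).aestronglyMeasurable
        measurableSet_Ioc)
    (by
      apply ContinuousOn.intervalIntegrable
      rw [uIcc_of_le hab.le]
      exact hVvc 0 h00)
    (by
      rw [uIoc_of_le hab.le]
      refine ContinuousOn.aestronglyMeasurable ?_ measurableSet_Ioc
      refine ContinuousOn.clm_apply ?_
        ((hηc.smul continuous_const).continuousOn)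
      intro s hs
      exact ContinuousAt.comp_continuousWithinAt (f := v 0)
        (Vpot_fderiv_continuousAt α hUC (hvne 0 h00 s (Ioc_subset_Icc_self hs)))
        ((hvc 0 s (Ioc_subset_Icc_self hs)).mono Ioc_subset_Icc_self))
    (by
      refine Eventually.of_forall fun s hs ε hε => ?_
      rw [uIoc_of_le hab.le] at hs
      have hs' := Ioc_subset_Icc_self hs
      refine (ContinuousLinearMap.le_opNorm _ _).trans ?_
      have := hC1b (v ε s) (hvlow ε (abs_lt.2 hε) s hs') (hvup ε (abs_lt.2 hε) s hs')
      rw [norm_smul]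
      gcongr
      exact hC' s)
    (continuous_const.intervalIntegrable _ _)
    (by
      refine Eventually.of_forall fun s hs ε hε => ?_
      rw [uIoc_of_le hab.le] at hs
      have hs' := Ioc_subset_Icc_self hs
      have h1 := Vpot_hasFDerivAt α hUC (hvne ε (abs_lt.2 hε) s hs')
      have h2 : HasDerivAt (fun ε => v ε s) (η s • e) ε := by
        have := (((hasDerivAt_id ε).mul_const (η s)).smul_const e).const_add (u s)
        simpa [v] using this
      exact h1.comp_hasDerivAt ε h2)).2
  rw [hv0] at hF
  -- integrals
  have iD : ∀ ε, |ε| < ε0 →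
      IntervalIntegrable (fun s => Vpot α U (v ε s) - Vpot α U (u s)) volume 0 1 := by
    intro ε hε
    rw [intervalIntegrable_iff_integrableOn_Ioc_of_le zero_le_one]
    refine IntegrableOn.of_forall_sdiff_eq_zero (s := Icc a b) ?_ measurableSet_Ioc ?_
    · apply ContinuousOn.integrableOn_Icc
      have := hVvc 0 h00
      rw [hv0] at this
      exact (hVvc ε hε).sub this
    · intro s hs
      rw [hvout ε s (fun h => hs.2 (Ioo_subset_Icc_self h)), sub_self]
  have hPε : ∀ ε, |ε| < ε0 → ∫ s in (0:ℝ)..1, (h + Vpot α U (v ε s)) =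
      P + ((∫ s in a..b, Vpot α U (v ε s)) - ∫ s in a..b, Vpot α U (u s)) := by
    intro ε hε
    have i1 : IntervalIntegrable (fun s => Vpot α U (v ε s)) volume a b := by
      apply ContinuousOn.intervalIntegrable
      rw [uIcc_of_le hab.le]; exact hVvc ε hε
    have i2 : IntervalIntegrable (fun s => Vpot α U (u s)) volume a b := by
      apply ContinuousOn.intervalIntegrable
      rw [uIcc_of_le hab.le]; have := hVvc 0 h00
      rwa [hv0] at this
    rw [← intervalIntegral.integral_sub i1 i2]
    have e1 : ∫ s in a..b, (Vpot α U (v ε s) - Vpot α U (u s)) =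
        ∫ s in (0:ℝ)..1, (Vpot α U (v ε s) - Vpot α U (u s)) := by
      rw [integral_of_le hab.le, integral_of_le zero_le_one]
      refine (setIntegral_eq_of_subset_of_forall_sdiff_eq_zero measurableSet_Ioc
          (Ioc_subset_Ioc ha.le hb.le) ?_).symm
      intro s hs
      rw [hvout ε s (fun h => hs.2 (Ioo_subset_Ioc_self h)), sub_self]
    rw [e1, hPdef, ← intervalIntegral.integral_add hI2 (iD ε hε)]
    congr 1; funext s; ring
  have hdi := deriv_int hI1
  have iJ : IntervalIntegrable (fun s => ζ s * inner ℝ e (deriv u s)) volume 0 1 := by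
    refine IntervalIntegrable.continuousOn_mul ?_ hζ.continuousOn
    refine IntervalIntegrable.mono_fun' (hdi.norm.const_mul ‖e‖) ?_ ?_
    · exact (stronglyMeasurable_const.inner (stronglyMeasurable_deriv u)).aestronglyMeasurable
    · exact Eventually.of_forall fun s => norm_inner_le_norm _ _
  set J := ∫ s in a..b, ζ s * inner ℝ e (deriv u s) with hJ
  have hJ' : J = ∫ s in (0:ℝ)..1, ζ s * inner ℝ e (deriv u s) := by
    rw [hJ, integral_of_le hab.le, integral_of_le zero_le_one]
    refine (setIntegral_eq_of_subset_of_forall_sdiff_eq_zero measurableSet_Ioc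
          (Ioc_subset_Ioc ha.le hb.le) ?_).symm
    intro s hs
    rw [hζs s (fun h => hs.2 (Ioo_subset_Ioc_self h)), zero_mul]
  set J2 := ∫ s in (0:ℝ)..1, ζ s ^ 2 * ‖e‖ ^ 2 with hJ2
  have iJ2 : IntervalIntegrable (fun s => ζ s ^ 2 * ‖e‖ ^ 2) volume 0 1 :=
    (by fun_prop : Continuous fun s => ζ s ^ 2 * ‖e‖ ^ 2).intervalIntegrable 0 1
  have hvd : ∀ ε, ∀ s ∈ Ioo (0:ℝ) 1, HasDerivAt (v ε) (deriv u s + (ε * ζ s) • e) s :=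
    fun ε s hs => (hdiff s hs).hasDerivAt.add (((hη s).const_mul ε).smul_const e)
  have hvn : ∀ ε, ∀ s ∈ Ioo (0:ℝ) 1, ‖deriv (v ε) s‖ ^ 2 =
      ‖deriv u s‖ ^ 2 + (2 * ε) * (ζ s * inner ℝ e (deriv u s)) +
        ε ^ 2 * (ζ s ^ 2 * ‖e‖ ^ 2) := by
    intro ε s hs
    rw [(hvd ε s hs).deriv, norm_add_sq_real, norm_smul, mul_pow, Real.norm_eq_abs, sq_abs,
      inner_smul_right, real_inner_comm]
    ring
  have hvint := fun ε : ℝ => (hI1.add (iJ.const_mul (2 * ε))).add (iJ2.const_mul (ε ^ 2))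
  have hAε : ∀ ε, ∫ s in (0:ℝ)..1, ‖deriv (v ε) s‖ ^ 2 = A + 2 * ε * J + ε ^ 2 * J2 := by
    intro ε
    rw [congr_Ioo_integral (hvn ε), intervalIntegral.integral_add
        (hI1.add (iJ.const_mul (2 * ε))) (iJ2.const_mul (ε ^ 2)),
        intervalIntegral.integral_add hI1 (iJ.const_mul (2 * ε)),
        intervalIntegral.integral_const_mul, intervalIntegral.integral_const_mul, hJ']
  have hadm : ∀ ε, |ε| < ε0 → HcollQ α h U q (v ε) := by
    intro ε hε
    refine ⟨?_, fun s hs => (hvd ε s hs).differentiableAt, ?_, ?_, ?_, ?_, ?_, ?_⟩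
    · exact hcont.add ((by fun_prop : Continuous fun s => (ε * η s) • e).continuousOn)
    · rw [hvout ε 0 (fun h => by linarith [h.1]), hu0]
    · rw [hvout ε 1 (fun h => by linarith [h.2]), hu1]
    · intro s hs
      by_cases h : s ∈ Icc a b
      · exact hvup ε hε s h
      · rw [hvout ε s (fun h' => h (Ioo_subset_Icc_self h'))]; exact hball s hs
    · filter_upwards [hne] with s hs hs2
      by_cases h : s ∈ Icc a b
      · exact hvne ε hε s h
      · rw [hvout ε s (fun h' => h (Ioo_subset_Icc_self h'))]; exact hs hs2
    · exact congr_Ioo_integrable (hvn ε) (hvint ε)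
    · refine (hI2.add (iD ε hε)).congr ?_
      intro s _
      ring
  -- the function of ε
  set D := ∫ s in a..b, fderiv ℝ (Vpot α U) (u s) (η s • e) with hD
  have hder : HasDerivAt (fun ε => (1 / 2 * (A + 2 * ε * J + ε ^ 2 * J2)) *
      (P + ((∫ s in a..b, Vpot α U (v ε s)) - ∫ s in a..b, Vpot α U (u s))))
      (J * P + 1 / 2 * A * D) 0 := by
    have h1 : HasDerivAt (fun ε : ℝ => 1 / 2 * (A + 2 * ε * J + ε ^ 2 * J2)) J 0 := by
      have t1 := (((hasDerivAt_id (0:ℝ)).const_mul 2).mul_const J).const_add A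
      have t2 := ((hasDerivAt_id (0:ℝ)).pow 2).mul_const J2
      have := (t1.add t2).const_mul (1 / 2)
      simpa using this
    have h2 := (hF.sub_const (∫ s in a..b, Vpot α U (u s))).const_add P
    exact (h1.fun_mul h2).congr_deriv (by simp [hv0])
  have hlm : IsLocalMin (fun ε => (1 / 2 * (A + 2 * ε * J + ε ^ 2 * J2)) *
      (P + ((∫ s in a..b, Vpot α U (v ε s)) - ∫ s in a..b, Vpot α U (u s)))) 0 := by
    filter_upwards [Ioo_mem_nhds (show -ε0 < 0 by linarith) hεpos] with ε hε
    have hle := hmin _ (hadm ε (abs_lt.2 hε))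
    unfold Maupertuis at hle
    rw [hAε, hPε ε (abs_lt.2 hε), ← hAdef, ← hPdef] at hle
    simpa [hv0] using hle
  have hfin := hlm.hasDerivAt_eq_zero hder
  have hD' : D = ∫ s in a..b, η s * fderiv ℝ (Vpot α U) (u s) e := by
    rw [hD]; congr 1; funext s; rw [map_smul, smul_eq_mul]
  rw [← hD']
  linarith

lemma el_strong {α h : ℝ} {U : E2 → ℝ} (hUC : ContDiff ℝ 2 U) {q : E2} {u : ℝ → E2}
    (hu : IsMinim α h U q u)
    (hP : 0 < ∫ s in (0:ℝ)..1, (h + Vpot α U (u s)))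
    (hnb : ∀ s ∈ Ioo (0:ℝ) 1, u s ≠ 0 ∧ ‖u s‖ < ‖q‖) :
    ∀ s ∈ Ioo (0:ℝ) 1, HasDerivAt (deriv u)
      (((∫ s in (0:ℝ)..1, ‖deriv u s‖ ^ 2) / 2 / (∫ s in (0:ℝ)..1, (h + Vpot α U (u s)))) •
        gradient (Vpot α U) (u s)) s := by
  set P := ∫ s in (0:ℝ)..1, (h + Vpot α U (u s)) with hPdef
  set A := ∫ s in (0:ℝ)..1, ‖deriv u s‖ ^ 2 with hAdef
  have hcoord : ∀ e : E2, ∀ s ∈ Ioo (0:ℝ) 1, HasDerivAt (fun s => inner ℝ e (deriv u s))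
      (A / 2 / P * fderiv ℝ (Vpot α U) (u s) e) s := by
    intro e
    let G : ℝ → ℝ := fun s => fderiv ℝ (Vpot α U) (u s) e
    have hGc : ∀ s ∈ Ioo (0:ℝ) 1, ContinuousAt G s := by
      intro s hs
      have h1 : ContinuousAt (fun s => fderiv ℝ (Vpot α U) (u s)) s :=
        ContinuousAt.comp (f := u) (Vpot_fderiv_continuousAt α hUC (hnb s hs).1)
          (hu.1.2.1 s hs).continuousAt
      exact h1.clm_apply continuousAt_const
    have hGco : ContinuousOn G (Ioo 0 1) := fun s hs => (hGc s hs).continuousWithinAt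
    have hsubI : ∀ x ∈ Ioo (0:ℝ) 1, ∀ y ∈ Ioo (0:ℝ) 1, uIcc x y ⊆ Ioo (0:ℝ) 1 :=
      fun x hx y hy => ordConnected_Ioo.uIcc_subset hx hy
    have hhalf : (1/2 : ℝ) ∈ Ioo (0:ℝ) 1 := by norm_num
    let F : ℝ → ℝ := fun s => ∫ x in (1/2:ℝ)..s, G x
    have hFd : ∀ s ∈ Ioo (0:ℝ) 1, HasDerivAt F (G s) s := by
      intro s hs
      refine integral_hasDerivAt_right
        (hGco.mono (hsubI _ hhalf s hs)).intervalIntegrable ?_ (hGc s hs)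
      exact hGco.stronglyMeasurableAtFilter isOpen_Ioo s hs
    have hFc : ContinuousOn F (Ioo 0 1) := fun s hs => (hFd s hs).continuousAt.continuousWithinAt
    let F2 : ℝ → ℝ := fun s => ∫ x in (1/2:ℝ)..s, F x
    have hF2d : ∀ s ∈ Ioo (0:ℝ) 1, HasDerivAt F2 (F s) s := by
      intro s hs
      refine integral_hasDerivAt_right
        (hFc.mono (hsubI _ hhalf s hs)).intervalIntegrable ?_ (hFd s hs).continuousAt
      exact hFc.stronglyMeasurableAtFilter isOpen_Ioo s hs
    let w : ℝ → ℝ := fun s => P * inner ℝ e (deriv u s) - A / 2 * F s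
    let W : ℝ → ℝ := fun s => P * inner ℝ e (u s) - A / 2 * F2 s
    have hWd : ∀ s ∈ Ioo (0:ℝ) 1, HasDerivAt W (w s) s := by
      intro s hs
      have h1 : HasDerivAt (fun s => inner ℝ e (u s)) (inner ℝ e (deriv u s)) s := by
        have := (hasDerivAt_const s e).inner ℝ (hu.1.2.1 s hs).hasDerivAt
        simpa using this
      exact (h1.const_mul P).sub ((hF2d s hs).const_mul (A / 2))
    have iJ : ∀ a b, 0 < a → a < b → b < 1 →
        IntervalIntegrable (fun s => inner ℝ e (deriv u s)) volume a b := by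
      intro a b ha hab hb
      have hdi := deriv_int hu.1.2.2.2.2.2.2.1
      have : IntervalIntegrable (fun s => inner ℝ e (deriv u s)) volume 0 1 := by
        refine IntervalIntegrable.mono_fun' (hdi.norm.const_mul ‖e‖) ?_ ?_
        · exact (stronglyMeasurable_const.inner
            (stronglyMeasurable_deriv u)).aestronglyMeasurable
        · exact Eventually.of_forall fun s => norm_inner_le_norm _ _
      apply this.mono_set
      rw [uIcc_of_le hab.le, uIcc_of_le zero_le_one]
      exact Icc_subset_Icc ha.le hb.le
    have iF : ∀ a b, 0 < a → a < b → b < 1 → IntervalIntegrable F volume a b :=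
      fun a b ha hab hb => (hFc.mono (hsubI a ⟨ha, by linarith⟩ b
        ⟨by linarith, hb⟩)).intervalIntegrable
    have iw : ∀ a b, 0 < a → a < b → b < 1 → IntervalIntegrable w volume a b :=
      fun a b ha hab hb => ((iJ a b ha hab hb).const_mul P).sub
        ((iF a b ha hab hb).const_mul (A / 2))
    have hweak : ∀ a b, 0 < a → a < b → b < 1 → ∀ η ζ : ℝ → ℝ, Continuous ζ →
      (∀ s, HasDerivAt η (ζ s) s) → (∀ s, 0 ≤ η s) → (∀ s, s ∉ Ioo a b → η s = 0) →
      (∀ s, s ∉ Ioo a b → ζ s = 0) → ∫ s in a..b, ζ s * w s = 0 := by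
      intro a b ha hab hb η ζ hζ hη _ hηs hζs
      have h1 := el_weak hUC hu hnb ha hab hb hζ hη hηs hζs e
      rw [← hPdef, ← hAdef] at h1
      have hIab := hsubI a ⟨ha, by linarith⟩ b ⟨by linarith, hb⟩
      have h2 := integral_mul_deriv_eq_deriv_mul (a := a) (b := b) (u := η) (v := F)
        (u' := ζ) (v' := G) (fun s _ => hη s) (fun s hs => hFd s (hIab hs))
        (hζ.intervalIntegrable _ _) (hGco.mono hIab).intervalIntegrable
      rw [hηs a (fun h => by linarith [h.1]), hηs b (fun h => by linarith [h.2])] at h2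
      have h3 : ∫ s in a..b, ζ s * w s = P * (∫ s in a..b, ζ s * inner ℝ e (deriv u s)) -
          A / 2 * ∫ s in a..b, ζ s * F s := by
        rw [← intervalIntegral.integral_const_mul, ← intervalIntegral.integral_const_mul,
          ← intervalIntegral.integral_sub
            (((iJ a b ha hab hb).continuousOn_mul hζ.continuousOn).const_mul _)
            (((iF a b ha hab hb).continuousOn_mul hζ.continuousOn).const_mul _)]
        congr 1; funext s; simp only [w]; ring
      have h4 : (∫ s in a..b, η s * fderiv ℝ (Vpot α U) (u s) e) = ∫ s in a..b, η s * G s := rfl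
      rw [h3]
      rw [h4, h2] at h1
      linarith
    have m1 : MonotoneOn w (Ioo 0 1) := weak_monotone hWd iw
      (fun a b ha hab hb η ζ c1 c2 c3 c4 c5 => (hweak a b ha hab hb η ζ c1 c2 c3 c4 c5).le)
    have m2 : MonotoneOn (fun s => - w s) (Ioo 0 1) := weak_monotone
      (W := fun s => - W s) (fun s hs => (hWd s hs).neg)
      (fun a b ha hab hb => (iw a b ha hab hb).neg)
      (fun a b ha hab hb η ζ c1 c2 c3 c4 c5 => by
        simp only [mul_neg, intervalIntegral.integral_neg]
        rw [hweak a b ha hab hb η ζ c1 c2 c3 c4 c5, neg_zero])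
    have hconst : ∀ s ∈ Ioo (0:ℝ) 1, w s = w (1/2) := by
      intro s hs
      rcases le_total s (1/2) with h | h
      · exact le_antisymm (m1 hs hhalf h) (by have := m2 hs hhalf h; simp only at this; linarith)
      · exact le_antisymm (by have := m2 hhalf hs h; simp only at this; linarith) (m1 hhalf hs h)
    intro s hs
    have h1 : HasDerivAt (fun s => (w (1/2) + A / 2 * F s) / P) (A / 2 * G s / P) s :=
      (((hFd s hs).const_mul (A / 2)).const_add _).div_const P
    have h2 : A / 2 / P * fderiv ℝ (Vpot α U) (u s) e = A / 2 * G s / P := by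
      simp only [G]; ring
    rw [h2]
    refine h1.congr_of_eventuallyEq ?_
    filter_upwards [isOpen_Ioo.mem_nhds hs] with t ht
    rw [← hconst t ht]
    simp only [w]
    field_simp
    ring
  intro s hs
  let B := EuclideanSpace.basisFun (Fin 2) ℝ
  have h1 : HasDerivAt (fun s => ∑ i, inner ℝ (B i) (deriv u s) • B i)
      (∑ i, (A / 2 / P * fderiv ℝ (Vpot α U) (u s) (B i)) • B i) s := by
    apply HasDerivAt.fun_sum
    intro i _
    exact (hcoord (B i) s hs).smul_const (B i)
  have e1 : (fun s => ∑ i, inner ℝ (B i) (deriv u s) • B i) = deriv u := by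
    funext t; exact B.sum_repr' (deriv u t)
  have e2 : (∑ i, (A / 2 / P * fderiv ℝ (Vpot α U) (u s) (B i)) • B i) =
      (A / 2 / P) • gradient (Vpot α U) (u s) := by
    rw [← B.sum_repr' ((A / 2 / P) • gradient (Vpot α U) (u s))]
    congr 1; funext i
    rw [inner_smul_right, real_inner_comm, inner_gradient_left]
  rw [e1, e2] at h1
  exact h1

lemma ode_lower {β c1 : ℝ} (hβ0 : 0 < β) (hβ1 : β < 1) (hc1 : 0 < c1) {f f1 f2 : ℝ → ℝ}
    (hfc : ContinuousOn f (Icc 0 1)) (hfp : ∀ s ∈ Ioo (0:ℝ) 1, 0 < f s) (hf1 : f 1 = 0)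
    (hd : ∀ s ∈ Ioo (0:ℝ) 1, HasDerivAt f (f1 s) s)
    (hd1 : ∀ s ∈ Ioo (0:ℝ) 1, HasDerivAt f1 (f2 s) s)
    (hneg : ∀ s ∈ Ioo (0:ℝ) 1, f1 s ≤ 0)
    (hode : ∀ s ∈ Ioo (0:ℝ) 1, c1 * f s ^ (-β) ≤ f2 s) :
    ∀ s ∈ Ioo (0:ℝ) 1, (1 + β) / 2 * Real.sqrt (2 * c1 / (1 - β)) * (1 - s) ≤
      f s ^ ((1 + β) / 2) := by
  have h1β : 0 < 1 - β := by linarith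
  set E : ℝ → ℝ := fun s => f1 s ^ 2 / 2 - c1 / (1 - β) * f s ^ (1 - β) with hE
  have hEd : ∀ s ∈ Ioo (0:ℝ) 1, HasDerivAt E (f1 s * (f2 s - c1 * f s ^ (-β))) s := by
    intro s hs
    have t1 := ((hd1 s hs).fun_pow 2).div_const 2
    have t2 := ((hd s hs).rpow_const (p := 1 - β) (Or.inl (hfp s hs).ne')).const_mul (c1 / (1 - β))
    refine (t1.sub t2).congr_deriv ?_
    have : (1 - β - 1) = -β := by ring
    rw [this]
    field_simp
    ring
  have hanti : AntitoneOn E (Ioo 0 1) := by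
    refine antitoneOn_of_deriv_nonpos (convex_Ioo 0 1)
      (fun s hs => (hEd s hs).continuousAt.continuousWithinAt) ?_ ?_
    · rw [interior_Ioo]; exact fun s hs => (hEd s hs).differentiableAt.differentiableWithinAt
    · rw [interior_Ioo]; intro s hs
      rw [(hEd s hs).deriv]
      exact mul_nonpos_of_nonpos_of_nonneg (hneg s hs) (by linarith [hode s hs])
  have hEnn : ∀ s ∈ Ioo (0:ℝ) 1, 0 ≤ E s := by
    intro s hs
    have hlim : Tendsto (fun t => -(c1 / (1 - β) * f t ^ (1 - β))) (nhdsWithin 1 (Ioo s 1))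
        (nhds (-(c1 / (1 - β) * f 1 ^ (1 - β)))) := by
      have h0 : Tendsto f (nhdsWithin 1 (Ioo s 1)) (nhds (f 1)) :=
        (hfc 1 (by simp)).mono_left (nhdsWithin_mono _ (fun x hx => ⟨hs.1.le.trans hx.1.le, hx.2.le⟩))
      exact ((h0.rpow_const (Or.inr h1β.le)).const_mul _).neg
    rw [hf1, Real.zero_rpow h1β.ne'] at hlim
    have : NeBot (nhdsWithin (1:ℝ) (Ioo s 1)) := by
      refine mem_closure_iff_nhdsWithin_neBot.1 ?_
      rw [closure_Ioo hs.2.ne]; exact ⟨hs.2.le, le_rfl⟩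
    have hle := le_of_tendsto hlim (b := E s) ?_
    · simpa using hle
    · filter_upwards [self_mem_nhdsWithin] with t ht
      have := hanti hs ⟨hs.1.trans ht.1, ht.2⟩ ht.1.le
      refine le_trans ?_ this
      simp only [hE]; nlinarith [sq_nonneg (f1 t)]
  set K := 2 * c1 / (1 - β) with hK
  have hKp : 0 < K := by positivity
  have hf1le : ∀ s ∈ Ioo (0:ℝ) 1, Real.sqrt K * f s ^ ((1 - β) / 2) ≤ - f1 s := by
    intro s hs
    have h2 := hEnn s hs
    simp only [hE] at h2
    have h3 : (f s ^ ((1 - β) / 2)) ^ 2 = f s ^ (1 - β) := by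
      rw [← Real.rpow_natCast, ← Real.rpow_mul (hfp s hs).le]; congr 1; push_cast; ring
    refine abs_le_of_sq_le_sq' ?_ (by linarith [hneg s hs]) |>.2
    rw [mul_pow, Real.sq_sqrt hKp.le, h3]
    have : K * f s ^ (1 - β) = 2 * (c1 / (1 - β) * f s ^ (1 - β)) := by rw [hK]; ring
    rw [this]; linarith
  set c3 := (1 + β) / 2 * Real.sqrt K with hc3
  set g : ℝ → ℝ := fun s => f s ^ ((1 + β) / 2) + c3 * s with hg
  have hgd : ∀ s ∈ Ioo (0:ℝ) 1, HasDerivAt g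
      (f1 s * ((1 + β) / 2) * f s ^ ((1 + β) / 2 - 1) + c3 * 1) s := by
    intro s hs
    exact ((hd s hs).rpow_const (Or.inl (hfp s hs).ne')).add ((hasDerivAt_id s).const_mul c3)
  have hganti : AntitoneOn g (Icc 0 1) := by
    refine antitoneOn_of_deriv_nonpos (convex_Icc 0 1) ?_ ?_ ?_
    · exact (hfc.rpow_const (fun _ _ => Or.inr (by linarith))).add (by fun_prop)
    · rw [interior_Icc]; exact fun s hs => (hgd s hs).differentiableAt.differentiableWithinAt
    · rw [interior_Icc]; intro s hs
      rw [(hgd s hs).deriv]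
      have h1 := hf1le s hs
      have h2 : f s ^ ((1 - β) / 2) * f s ^ ((1 + β) / 2 - 1) = 1 := by
        rw [← Real.rpow_add (hfp s hs)]
        rw [show (1 - β) / 2 + ((1 + β) / 2 - 1) = 0 by ring, Real.rpow_zero]
      have h3 : 0 ≤ f s ^ ((1 + β) / 2 - 1) := Real.rpow_nonneg (hfp s hs).le _
      have h4 := mul_le_mul_of_nonneg_right h1 h3
      rw [mul_assoc, h2, mul_one] at h4
      rw [hc3]
      have h5 := mul_le_mul_of_nonneg_left h4 (show 0 ≤ (1 + β) / 2 by linarith)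
      nlinarith
  intro s hs
  have := hganti (Ioo_subset_Icc_self hs) (right_mem_Icc.2 zero_le_one) hs.2.le
  simp only [hg, hf1] at this
  rw [Real.zero_rpow (by linarith)] at this
  linarith

lemma energy_all {α h : ℝ} {U : E2 → ℝ} (hUC : ContDiff ℝ 2 U) {q : E2} {u : ℝ → E2}
    (hu : IsMinim α h U q u)
    (hP : 0 < ∫ s in (0:ℝ)..1, (h + Vpot α U (u s)))
    (hnb : ∀ s ∈ Ioo (0:ℝ) 1, u s ≠ 0 ∧ ‖u s‖ < ‖q‖) :
    ∀ s ∈ Ioo (0:ℝ) 1, ‖deriv u s‖ ^ 2 =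
      2 * ((∫ s in (0:ℝ)..1, ‖deriv u s‖ ^ 2) / 2 / (∫ s in (0:ℝ)..1, (h + Vpot α U (u s)))) *
        (h + Vpot α U (u s)) := by
  have hae := energy_ae hu hP
  have hel := el_strong hUC hu hP hnb
  set P := ∫ s in (0:ℝ)..1, (h + Vpot α U (u s)) with hPdef
  set A := ∫ s in (0:ℝ)..1, ‖deriv u s‖ ^ 2 with hAdef
  have := Measure.eqOn_open_of_ae_eq (μ := (volume : Measure ℝ)) (U := Ioo (0:ℝ) 1)
    (f := fun s => P * ‖deriv u s‖ ^ 2) (g := fun s => A * (h + Vpot α U (u s))) ?_ isOpen_Ioo ?_ ?_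
  · intro s hs
    have h1 := this hs
    simp only at h1
    field_simp
    linarith
  · rw [Filter.EventuallyEq, ae_restrict_iff' measurableSet_Ioo]; exact hae
  · intro s hs
    have := (hel s hs).continuousAt
    exact (continuousAt_const.mul (this.norm.pow 2)).continuousWithinAt
  · intro s hs
    have h1 : ContinuousAt (fun s => Vpot α U (u s)) s :=
      ContinuousAt.comp (f := u) (Vpot_continuousAt α hUC (hnb s hs).1) (hu.1.2.1 s hs).continuousAt
    exact (continuousAt_const.mul (continuousAt_const.add h1)).continuousWithinAt

/-- Uniform lower bound near the collision. -/
lemma collision_lower {α Umin κ lmin : ℝ} (hα : α ∈ Ioo (0:ℝ) 2) {U : E2 → ℝ}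
    (hUC : ContDiff ℝ 2 U)
    (hUmin : ∀ s : E2, ‖s‖ = 1 → Umin ≤ U s) (hU0 : 0 < Umin) (hκ : 0 < κ) (hl : 0 < lmin) :
    ∃ c : ℝ, 0 < c ∧ ∀ (h : ℝ) (q : E2) (u : ℝ → E2), IsMinim α h U q u → q ≠ 0 →
      (∀ x : E2, x ≠ 0 → ‖x‖ ≤ ‖q‖ → κ * Vpot α U x ≤ 2 * h + (2 - α) * Vpot α U x) →
      (0 < ∫ s in (0:ℝ)..1, (h + Vpot α U (u s))) →
      lmin ≤ (∫ s in (0:ℝ)..1, ‖deriv u s‖ ^ 2) / 2 / (∫ s in (0:ℝ)..1, (h + Vpot α U (u s))) →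
      ∀ s ∈ Ioo (0:ℝ) 1, c * (1 - s) ^ (2 / (2 + α)) ≤ ‖u s‖ := by
  obtain ⟨hα0, hα2⟩ := hα
  set β := α / 2 with hβ
  have hβ0 : 0 < β := by rw [hβ]; linarith
  have hβ1 : β < 1 := by rw [hβ]; linarith
  set c1 := lmin * κ * Umin * (2:ℝ) ^ (-β) with hc1
  have hc1p : 0 < c1 := by positivity
  set c3 := (1 + β) / 2 * Real.sqrt (2 * c1 / (1 - β)) with hc3
  have hc3p : 0 < c3 := by
    have : 0 < 1 - β := by linarith
    positivity
  refine ⟨c3 ^ (2 / (2 + α)), by positivity, ?_⟩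
  intro h q u hu hq hκV hP hlm
  have hVnn := Vpot_nonneg (α := α) hα0 hUmin hU0
  have hG : ∀ x : E2, x ≠ 0 → ‖x‖ ≤ ‖q‖ → 0 ≤ 2 * h + (2 - α) * Vpot α U x := fun x hx hxq =>
    le_trans (mul_nonneg hκ.le (hVnn x)) (hκV x hx hxq)
  have hconv := sq_norm_convex ⟨hα0, hα2⟩ hUmin hU0 hu hG hP
  have hnb := norm_bounds ⟨hα0, hα2⟩ hUmin hU0 hu hG hP hq
  have hen := energy_all hUC hu hP hnb
  have hel := el_strong hUC hu hP hnb
  obtain ⟨hcont, hdiff, hu0, hu1, hball, hne, hI1, hI2⟩ := hu.1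
  set P := ∫ s in (0:ℝ)..1, (h + Vpot α U (u s)) with hPdef
  set A := ∫ s in (0:ℝ)..1, ‖deriv u s‖ ^ 2 with hAdef
  set l := A / 2 / P with hldef
  have hd : ∀ s ∈ Ioo (0:ℝ) 1,
      HasDerivAt (fun s => ‖u s‖ ^ 2 / 2) (inner ℝ (u s) (deriv u s)) s := by
    intro s hs
    have := ((hdiff s hs).hasDerivAt.norm_sq).div_const 2
    exact this.congr_deriv (by ring)
  have key := ode_lower (f := fun s => ‖u s‖ ^ 2 / 2) (f1 := fun s => inner ℝ (u s) (deriv u s))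
    (f2 := fun s => l * (2 * h + (2 - α) * Vpot α U (u s))) hβ0 hβ1 hc1p
    ((hcont.norm.pow 2).div_const 2) ?_ ?_ hd ?_ ?_ ?_
  · intro s hs
    have h1 := key s hs
    rw [← hc3] at h1
    have hn : 0 < ‖u s‖ := norm_pos_iff.2 (hnb s hs).1
    have h2 : (‖u s‖ ^ 2 / 2) ^ ((1 + β) / 2) ≤ ‖u s‖ ^ ((2 + α) / 2) := by
      calc (‖u s‖ ^ 2 / 2) ^ ((1 + β) / 2) ≤ (‖u s‖ ^ 2) ^ ((1 + β) / 2) :=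
            Real.rpow_le_rpow (by positivity) (by linarith [sq_nonneg ‖u s‖]) (by linarith)
        _ = ‖u s‖ ^ ((2 + α) / 2) := by
            rw [← Real.rpow_natCast, ← Real.rpow_mul hn.le]; congr 1; rw [hβ]; push_cast; ring
    have h3 := h1.trans h2
    have h1s : 0 < 1 - s := by linarith [hs.2]
    rw [← Real.mul_rpow hc3p.le h1s.le]
    calc (c3 * (1 - s)) ^ (2 / (2 + α)) ≤ (‖u s‖ ^ ((2 + α) / 2)) ^ (2 / (2 + α)) :=
          Real.rpow_le_rpow (by positivity) h3 (by positivity)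
      _ = ‖u s‖ := by
          rw [← Real.rpow_mul hn.le]
          rw [show (2 + α) / 2 * (2 / (2 + α)) = 1 by field_simp, Real.rpow_one]
  · intro s hs
    have hn : 0 < ‖u s‖ := norm_pos_iff.2 (hnb s hs).1
    positivity
  · simp [hu1]
  · intro s hs
    have h1 := ((hdiff s hs).hasDerivAt).inner ℝ (hel s hs)
    refine h1.congr_deriv ?_
    have h2 := hen s hs
    rw [inner_smul_right, real_inner_self_eq_norm_sq, h2, real_inner_comm, inner_gradient_left,
      Vpot_euler α hUC (hnb s hs).1]
    ring
  · intro s hs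
    have hsl := hconv.le_slope_of_hasDerivAt (Ioo_subset_Icc_self hs) (right_mem_Icc.2 zero_le_one)
      hs.2 (hd s hs)
    have : slope (fun s => ‖u s‖ ^ 2 / 2) s 1 ≤ 0 := by
      rw [slope_def_field, hu1]
      apply div_nonpos_of_nonpos_of_nonneg
      · simp only [norm_zero]; nlinarith [sq_nonneg ‖u s‖]
      · linarith [hs.2]
    exact hsl.trans this
  · intro s hs
    have hn : 0 < ‖u s‖ := norm_pos_iff.2 (hnb s hs).1
    have h1 := hκV (u s) (hnb s hs).1 (hnb s hs).2.le
    have h2 := Vpot_ge (α := α) hUmin (hnb s hs).1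
    have h3 : (2:ℝ) ^ (-β) * (‖u s‖ ^ 2 / 2) ^ (-β) = ‖u s‖ ^ (-α) := by
      rw [← Real.mul_rpow (by norm_num) (by positivity)]
      rw [show 2 * (‖u s‖ ^ 2 / 2) = ‖u s‖ ^ 2 by ring, ← Real.rpow_natCast,
        ← Real.rpow_mul hn.le]
      congr 1; rw [hβ]; push_cast; ring
    calc c1 * (‖u s‖ ^ 2 / 2) ^ (-β) = lmin * (κ * (Umin * ‖u s‖ ^ (-α))) := by
          rw [← h3, hc1]; ring
      _ ≤ lmin * (κ * Vpot α U (u s)) := by gcongr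
      _ ≤ l * (κ * Vpot α U (u s)) := by
          gcongr
          exact mul_nonneg hκ.le (hVnn _)
      _ ≤ l * (2 * h + (2 - α) * Vpot α U (u s)) := by
          have : 0 ≤ l := hl.le.trans hlm
          gcongr

lemma kappa_exists {α h Umin R : ℝ} (hα : α ∈ Ioo (0:ℝ) 2) (hh : h < 0) {U : E2 → ℝ}
    (hUmin : ∀ s : E2, ‖s‖ = 1 → Umin ≤ U s) (hU0 : 0 < Umin) (hR : 0 < R)
    (hRLJ : R < ((2 - α) * Umin / (-2 * h)) ^ (1/α)) :
    ∃ κ : ℝ, 0 < κ ∧ ∀ h' : ℝ, h < h' → ∀ x : E2, x ≠ 0 → ‖x‖ ≤ R →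
      κ * Vpot α U x ≤ 2 * h' + (2 - α) * Vpot α U x ∧
      α / 2 * (Umin * R ^ (-α)) ≤ h' + Vpot α U x := by
  obtain ⟨hα0, hα2⟩ := hα
  have hRα : R ^ α < (2 - α) * Umin / (-2 * h) := by
    have h0 : 0 ≤ (2 - α) * Umin / (-2 * h) := by
      apply div_nonneg
      · exact mul_nonneg (by linarith) hU0.le
      · linarith
    calc R ^ α < (((2 - α) * Umin / (-2 * h)) ^ (1/α)) ^ α := Real.rpow_lt_rpow hR.le hRLJ hα0
      _ = (2 - α) * Umin / (-2 * h) := by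
        rw [← Real.rpow_mul h0, one_div_mul_cancel hα0.ne', Real.rpow_one]
  have hRp : 0 < R ^ α := by positivity
  rw [lt_div_iff₀ (by linarith)] at hRα
  set κ := (2 - α) - R ^ α * (-2 * h) / Umin with hκ
  have hκp : 0 < κ := by
    rw [hκ, sub_pos, div_lt_iff₀ hU0]; exact hRα
  refine ⟨κ, hκp, ?_⟩
  intro h' hh' x hx hxR
  have hxp : 0 < ‖x‖ := norm_pos_iff.2 hx
  have h1 := Vpot_ge (α := α) hUmin hx
  have h2 : R ^ (-α) ≤ ‖x‖ ^ (-α) := Real.rpow_le_rpow_of_nonpos hxp hxR (by linarith)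
  have h3 : Umin * R ^ (-α) ≤ Vpot α U x := le_trans (by gcongr) h1
  have h4 : Umin ≤ Vpot α U x * R ^ α := by
    rw [Real.rpow_neg hR.le] at h3
    have := mul_le_mul_of_nonneg_right h3 hRp.le
    rwa [mul_assoc, inv_mul_cancel₀ hRp.ne', mul_one] at this
  have hV0 : 0 ≤ Vpot α U x := Vpot_nonneg hα0 hUmin hU0 x
  have h5 : -2 * h ≤ R ^ α * (-2 * h) / Umin * Vpot α U x := by
    rw [div_mul_eq_mul_div, le_div_iff₀ hU0]
    nlinarith
  have h6 : κ * Vpot α U x ≤ 2 * h' + (2 - α) * Vpot α U x := by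
    rw [hκ, sub_mul]; linarith
  refine ⟨h6, ?_⟩
  have h7 : 0 ≤ κ * Vpot α U x := mul_nonneg hκp.le hV0
  nlinarith

lemma P_lower {α h q0 R : ℝ} {U : E2 → ℝ} {q : E2} {u : ℝ → E2} (hu : HcollQ α h U q u)
    (hqR : ‖q‖ ≤ R) (hb : ∀ x : E2, x ≠ 0 → ‖x‖ ≤ R → q0 ≤ h + Vpot α U x) :
    q0 ≤ ∫ s in (0:ℝ)..1, (h + Vpot α U (u s)) := by
  obtain ⟨hcont, hdiff, hu0, hu1, hball, hne, hI1, hI2⟩ := hu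
  have : (∫ s in (0:ℝ)..1, q0) ≤ ∫ s in (0:ℝ)..1, (h + Vpot α U (u s)) := by
    refine integral_mono_ae_restrict zero_le_one (by simp) hI2 ?_
    rw [Filter.EventuallyLE, ae_restrict_iff' measurableSet_Icc]
    filter_upwards [hne] with s hs hs1
    exact hb _ (hs hs1) ((hball s hs1).trans hqR)
  simpa using this

lemma A_lower {α h : ℝ} {U : E2 → ℝ} {q : E2} {u : ℝ → E2} (hu : HcollQ α h U q u)
    (hq : q ≠ 0) : ‖q‖ ^ 2 ≤ ∫ s in (0:ℝ)..1, ‖deriv u s‖ ^ 2 := by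
  obtain ⟨hcont, hdiff, hu0, hu1, hball, hne, hI1, hI2⟩ := hu
  have hI := deriv_int hI1
  have hqp : 0 < ‖q‖ := norm_pos_iff.2 hq
  have h1 : ∫ s in (0:ℝ)..1, deriv u s = u 1 - u 0 :=
    integral_eq_sub_of_hasDerivAt_of_le zero_le_one hcont
      (fun s hs => (hdiff s hs).hasDerivAt) hI
  have h2 : ‖q‖ ≤ ∫ s in (0:ℝ)..1, ‖deriv u s‖ := by
    have := norm_integral_le_integral_norm (f := deriv u) (μ := volume) (zero_le_one (α := ℝ))
    rw [h1, hu0, hu1, zero_sub, norm_neg] at this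
    exact this
  have h3 : (∫ s in (0:ℝ)..1, ‖deriv u s‖) * (2 * ‖q‖) ≤
      ∫ s in (0:ℝ)..1, (‖deriv u s‖ ^ 2 + ‖q‖ ^ 2) := by
    rw [← intervalIntegral.integral_mul_const]
    refine mono_Ioo_integral (hI.norm.mul_const _) (hI1.add (by simp)) ?_
    intro s _
    nlinarith [sq_nonneg (‖deriv u s‖ - ‖q‖)]
  rw [intervalIntegral.integral_add hI1 (by simp)] at h3
  simp only [intervalIntegral.integral_const, sub_zero, one_smul] at h3
  nlinarith

/-- rotation by a right angle -/
noncomputable def Jrot : E2 →L[ℝ] E2 :=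
  LinearMap.toContinuousLinearMap
    { toFun := fun x => !₂[-x 1, x 0]
      map_add' := by intro x y; ext i; fin_cases i <;> simp; ring
      map_smul' := by intro c x; ext i; fin_cases i <;> simp }

lemma Jrot_apply (x : E2) : Jrot x = !₂[-x 1, x 0] := rfl

/-- the similarity which sends the first point to the second one -/
noncomputable def Lsim (q q' : E2) : E2 →L[ℝ] E2 :=
  ((q' 0 * q 0 + q' 1 * q 1) / ‖q‖ ^ 2) • ContinuousLinearMap.id ℝ E2 +
    ((q' 1 * q 0 - q' 0 * q 1) / ‖q‖ ^ 2) • Jrot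

lemma nsq (x : E2) : ‖x‖ ^ 2 = x 0 ^ 2 + x 1 ^ 2 := by
  rw [EuclideanSpace.norm_sq_eq]; simp [Fin.sum_univ_two]

lemma Lsim_coord (q q' x : E2) : Lsim q q' x = !₂[
    (q' 0 * q 0 + q' 1 * q 1) / ‖q‖ ^ 2 * x 0 - (q' 1 * q 0 - q' 0 * q 1) / ‖q‖ ^ 2 * x 1,
    (q' 0 * q 0 + q' 1 * q 1) / ‖q‖ ^ 2 * x 1 + (q' 1 * q 0 - q' 0 * q 1) / ‖q‖ ^ 2 * x 0] := by
  ext i; fin_cases i <;> simp [Lsim, Jrot_apply]; ring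

lemma Lsim_norm {q q' : E2} (hq : q ≠ 0) (x : E2) : ‖Lsim q q' x‖ = ‖q'‖ / ‖q‖ * ‖x‖ := by
  have hqp : 0 < ‖q‖ := norm_pos_iff.2 hq
  refine (sq_eq_sq₀ (norm_nonneg _) (by positivity)).1 ?_
  rw [mul_pow, div_pow, nsq, Lsim_coord, nsq x, nsq q']
  have := nsq q
  have h2 : ‖q‖ ^ 2 ≠ 0 := by positivity
  simp only [Matrix.cons_val_zero, Matrix.cons_val_one]
  set N := ‖q‖ ^ 2
  field_simp
  rw [this]
  ring

lemma Lsim_self {q q' : E2} (hq : q ≠ 0) : Lsim q q' q = q' := by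
  have hqp : 0 < ‖q‖ := norm_pos_iff.2 hq
  have := nsq q
  have h2 : ‖q‖ ^ 2 ≠ 0 := by positivity
  rw [Lsim_coord]
  set N := ‖q‖ ^ 2
  ext i; fin_cases i
  · simp; field_simp; rw [this]; ring
  · simp; field_simp; rw [this]; ring

lemma Lsim_tendsto {q : E2} (hq : q ≠ 0) {qk : ℕ → E2} (hqk : Tendsto qk atTop (nhds q)) (x : E2) :
    Tendsto (fun k => Lsim q (qk k) x) atTop (nhds x) := by
  have hc : Continuous (fun q' : E2 => Lsim q q' x) := by
    unfold Lsim
    fun_prop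
  have h1 := (hc.tendsto q).comp hqk
  have h2 : Lsim q q x = x := by
    have hqp : 0 < ‖q‖ := norm_pos_iff.2 hq
    have := nsq q
    have h2 : ‖q‖ ^ 2 ≠ 0 := by positivity
    rw [Lsim_coord]
    rw [show q 0 * q 0 + q 1 * q 1 = ‖q‖ ^ 2 by rw [nsq]; ring, div_self h2]
    ext i; fin_cases i <;> simp <;> (left; left; ring)
  rw [h2] at h1
  exact h1

lemma Lsim_deriv {α h : ℝ} {U : E2 → ℝ} {q q' : E2} {v : ℝ → E2} (hv : HcollQ α h U q v)
    (hq : q ≠ 0) {s : ℝ} (hs : s ∈ Ioo (0:ℝ) 1) :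
    DifferentiableAt ℝ (fun s => Lsim q q' (v s)) s ∧
    ‖deriv (fun s => Lsim q q' (v s)) s‖ ^ 2 = (‖q'‖ / ‖q‖) ^ 2 * ‖deriv v s‖ ^ 2 := by
  have h1 : HasDerivAt (fun s => Lsim q q' (v s)) (Lsim q q' (deriv v s)) s :=
    (Lsim q q').hasFDerivAt.comp_hasDerivAt s (hv.2.1 s hs).hasDerivAt
  refine ⟨h1.differentiableAt, ?_⟩
  rw [h1.deriv, Lsim_norm hq, mul_pow]

lemma Lsim_V {α Umin Umax : ℝ} {U : E2 → ℝ}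
    (hUmin : ∀ s : E2, ‖s‖ = 1 → Umin ≤ U s) (hU0 : 0 < Umin)
    (hUmax : ∀ s : E2, ‖s‖ = 1 → U s ≤ Umax) (hUm0 : 0 < Umax) {q q' x : E2}
    (hq : q ≠ 0) (hq' : q' ≠ 0) (hx : x ≠ 0) :
    Lsim q q' x ≠ 0 ∧
    Vpot α U (Lsim q q' x) ≤ Umax / Umin * (‖q'‖ / ‖q‖) ^ (-α) * Vpot α U x := by
  have hqp : 0 < ‖q‖ := norm_pos_iff.2 hq
  have hqp' : 0 < ‖q'‖ := norm_pos_iff.2 hq'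
  have hxp : 0 < ‖x‖ := norm_pos_iff.2 hx
  have hL : Lsim q q' x ≠ 0 := by
    rw [← norm_pos_iff, Lsim_norm hq]; positivity
  refine ⟨hL, ?_⟩
  refine (Vpot_le hUmax hL).trans ?_
  rw [Lsim_norm hq, Real.mul_rpow (by positivity) hxp.le]
  have h1 := Vpot_ge (α := α) hUmin hx
  calc Umax * ((‖q'‖ / ‖q‖) ^ (-α) * ‖x‖ ^ (-α))
      = Umax / Umin * (‖q'‖ / ‖q‖) ^ (-α) * (Umin * ‖x‖ ^ (-α)) := by field_simp
    _ ≤ _ := by gcongr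

lemma Lsim_meas {α h : ℝ} {U : E2 → ℝ} (hUc : Continuous U) {q q' : E2} {v : ℝ → E2}
    (hv : HcollQ α h U q v) :
    AEStronglyMeasurable (fun s => Vpot α U (Lsim q q' (v s))) (volume.restrict (Ioc 0 1)) := by
  have h1 : AEStronglyMeasurable v (volume.restrict (Ioc 0 1)) :=
    (hv.1.mono Ioc_subset_Icc_self).aestronglyMeasurable measurableSet_Ioc
  have h2 : AEMeasurable (fun s => Lsim q q' (v s)) (volume.restrict (Ioc 0 1)) :=
    (Lsim q q').continuous.measurable.comp_aemeasurable h1.aemeasurable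
  exact ((Vpot_measurable α hUc).comp_aemeasurable h2).aestronglyMeasurable

lemma Lsim_Hcoll {α h Umin h' : ℝ} (hα : 0 < α) {U : E2 → ℝ} (hUc : Continuous U)
    (hUmin : ∀ s : E2, ‖s‖ = 1 → Umin ≤ U s) (hU0 : 0 < Umin) {q q' : E2}
    {v : ℝ → E2} (hv : HcollQ α h U q v) (hq : q ≠ 0) (hq' : q' ≠ 0) :
    HcollQ α h' U q' (fun s => Lsim q q' (v s)) := by
  obtain ⟨Umax, hUm0, hUmax⟩ := exists_Umax hUc
  have hqp : 0 < ‖q‖ := norm_pos_iff.2 hq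
  have hVi := Vpot_int hv
  have hmeas := Lsim_meas (q' := q') hUc hv
  have hD := fun s (hs : s ∈ Ioo (0:ℝ) 1) => Lsim_deriv (q' := q') hv hq hs
  obtain ⟨hcont, hdiff, hu0, hu1, hball, hne, hI1, hI2⟩ := hv
  refine ⟨(Lsim q q').continuous.comp_continuousOn hcont, fun s hs => (hD s hs).1, ?_, ?_, ?_, ?_,
    ?_, ?_⟩
  · simp only [hu0]; exact Lsim_self hq
  · simp only [hu1, map_zero]
  · intro s hs
    rw [Lsim_norm hq, div_mul_eq_mul_div, div_le_iff₀ hqp]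
    exact mul_le_mul_of_nonneg_left (hball s hs) (norm_nonneg _)
  · filter_upwards [hne] with s hs hs1
    exact (Lsim_V (α := 1) hUmin hU0 hUmax hUm0 hq hq' (hs hs1)).1
  · exact congr_Ioo_integrable (fun s hs => (hD s hs).2) (hI1.const_mul _)
  · refine (continuous_const.intervalIntegrable 0 1).add ?_
    refine IntervalIntegrable.mono_fun'
      (hVi.const_mul (Umax / Umin * (‖q'‖ / ‖q‖) ^ (-α))) ?_ ?_
    · rw [uIoc_of_le zero_le_one]; exact hmeas
    · rw [uIoc_of_le zero_le_one]
      refine (ae_restrict_iff' measurableSet_Ioc).2 ?_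
      filter_upwards [hne] with s hs hs1
      rw [Real.norm_of_nonneg (Vpot_nonneg hα hUmin hU0 _)]
      exact (Lsim_V hUmin hU0 hUmax hUm0 hq hq' (hs (Ioc_subset_Icc_self hs1))).2

lemma Lsim_Maup {α h Umin : ℝ} (hα : 0 < α) {U : E2 → ℝ} (hUC : ContDiff ℝ 2 U)
    (hUmin : ∀ s : E2, ‖s‖ = 1 → Umin ≤ U s) (hU0 : 0 < Umin) {q : E2}
    {v : ℝ → E2} (hv : HcollQ α h U q v) (hq : q ≠ 0) {qk : ℕ → E2} (hqk0 : ∀ k, qk k ≠ 0)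
    (hqk : Tendsto qk atTop (nhds q)) {hk : ℕ → ℝ} (hhk : Tendsto hk atTop (nhds h)) :
    Tendsto (fun k => Maupertuis α (hk k) U (fun s => Lsim q (qk k) (v s))) atTop
      (nhds (Maupertuis α h U v)) := by
  obtain ⟨Umax, hUm0, hUmax⟩ := exists_Umax hUC.continuous
  have hqp : 0 < ‖q‖ := norm_pos_iff.2 hq
  have hVi := Vpot_int hv
  have hmeas := fun q' => Lsim_meas (q' := q') hUC.continuous hv
  have hD := fun k s (hs : s ∈ Ioo (0:ℝ) 1) => Lsim_deriv (q' := qk k) hv hq hs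
  have hHc := fun k => Lsim_Hcoll (h' := hk k) hα hUC.continuous hUmin hU0 hv hq (hqk0 k)
  obtain ⟨hcont, hdiff, hu0, hu1, hball, hne, hI1, hI2⟩ := hv
  have hρ : Tendsto (fun k => ‖qk k‖ / ‖q‖) atTop (nhds 1) := by
    have := hqk.norm.div_const ‖q‖
    rwa [div_self hqp.ne'] at this
  have hρα : Tendsto (fun k => (‖qk k‖ / ‖q‖) ^ (-α)) atTop (nhds 1) := by
    have := hρ.rpow_const (p := -α) (Or.inl one_ne_zero)
    rwa [Real.one_rpow] at this
  unfold Maupertuis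
  refine Tendsto.mul (Tendsto.const_mul _ ?_) ?_
  · have : (fun k => ∫ s in (0:ℝ)..1, ‖deriv (fun s => Lsim q (qk k) (v s)) s‖ ^ 2) =
        fun k => (‖qk k‖ / ‖q‖) ^ 2 * ∫ s in (0:ℝ)..1, ‖deriv v s‖ ^ 2 := by
      funext k
      rw [← intervalIntegral.integral_const_mul]
      exact congr_Ioo_integral (fun s hs => (hD k s hs).2)
    rw [this]
    have := (hρ.pow 2).mul_const (∫ s in (0:ℝ)..1, ‖deriv v s‖ ^ 2)
    rwa [one_pow, one_mul] at this
  · have hsplit : ∀ k, (∫ s in (0:ℝ)..1, (hk k + Vpot α U (Lsim q (qk k) (v s)))) =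
        hk k + ∫ s in (0:ℝ)..1, Vpot α U (Lsim q (qk k) (v s)) := by
      intro k
      rw [intervalIntegral.integral_add (by simp) (Vpot_int (hHc k))]
      simp
    have hsplit' : (∫ s in (0:ℝ)..1, (h + Vpot α U (v s))) =
        h + ∫ s in (0:ℝ)..1, Vpot α U (v s) := by
      rw [intervalIntegral.integral_add (by simp) hVi]
      simp
    simp only [hsplit, hsplit']
    refine hhk.add ?_
    refine intervalIntegral.tendsto_integral_filter_of_dominated_convergence
      (fun s => Umax / Umin * 2 * Vpot α U (v s)) ?_ ?_ (hVi.const_mul _) ?_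
    · refine Eventually.of_forall fun k => ?_
      rw [uIoc_of_le zero_le_one]; exact hmeas _
    · filter_upwards [hρα.eventually_le_const (show (1:ℝ) < 2 by norm_num)] with k hk2
      rw [uIoc_of_le zero_le_one]
      filter_upwards [hne] with s hs hs1
      rw [Real.norm_of_nonneg (Vpot_nonneg hα hUmin hU0 _)]
      refine (Lsim_V hUmin hU0 hUmax hUm0 hq (hqk0 k) (hs (Ioc_subset_Icc_self hs1))).2.trans ?_
      have := Vpot_nonneg hα hUmin hU0 (v s)
      gcongr
    · rw [uIoc_of_le zero_le_one]
      filter_upwards [hne] with s hs hs1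
      have hx := hs (Ioc_subset_Icc_self hs1)
      exact (Vpot_continuousAt α hUC hx).tendsto.comp (Lsim_tendsto hq hqk _)

lemma ae_ne_pt (a : ℝ) : ∀ᵐ s : ℝ, s ≠ a := by
  rw [ae_iff]; simp

lemma ae_Ioo_of {p : ℝ → Prop} (h : ∀ s ∈ Ioo (0:ℝ) 1, p s) :
    ∀ᵐ s : ℝ, s ∈ uIoc (0:ℝ) 1 → p s := by
  rw [uIoc_of_le zero_le_one]
  filter_upwards [ae_ne_pt 1] with s hs hs1
  exact h s ⟨hs1.1, lt_of_le_of_ne hs1.2 hs⟩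

lemma compact_abstract {v : ℕ → ℝ → E2} {G : ℝ → ℝ} {q : E2} {R : ℝ}
    (hc : ∀ k, ContinuousOn (v k) (Icc 0 1))
    (hd : ∀ k, ∀ s ∈ Ioo (0:ℝ) 1, DifferentiableAt ℝ (v k) s)
    (hv1 : ∀ k, v k 1 = 0) (hv0 : Tendsto (fun k => v k 0) atTop (nhds q))
    (hR : ∀ k, ∀ s ∈ Icc (0:ℝ) 1, ‖v k s‖ ≤ R)
    (hG : IntervalIntegrable G volume 0 1)
    (hGb : ∀ k, ∀ s ∈ Ioo (0:ℝ) 1, ‖deriv (v k) s‖ ^ 2 ≤ G s)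
    (hlip : ∀ t0 < 1, ∃ C : ℝ, ∀ k, ∀ s ∈ Ioo (0:ℝ) t0, ∀ t ∈ Ioo (0:ℝ) t0,
      ‖deriv (v k) t - deriv (v k) s‖ ≤ C * |t - s|) :
    ∃ (φ : ℕ → ℕ) (w : ℝ → E2), StrictMono φ ∧ ContinuousOn w (Icc 0 1) ∧
      (∀ s ∈ Ioo (0:ℝ) 1, DifferentiableAt ℝ w s) ∧ w 0 = q ∧ w 1 = 0 ∧
      (∀ s ∈ Icc (0:ℝ) 1, Tendsto (fun k => v (φ k) s) atTop (nhds (w s))) ∧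
      IntervalIntegrable (fun s => ‖deriv w s‖ ^ 2) volume 0 1 ∧
      Tendsto (fun k => ∫ s in (0:ℝ)..1, ‖deriv (v (φ k)) s‖ ^ 2) atTop
        (nhds (∫ s in (0:ℝ)..1, ‖deriv w s‖ ^ 2)) ∧
      Tendsto (fun k => ∫ s in (0:ℝ)..1, ‖v (φ k) s - w s‖ ^ 2) atTop (nhds 0) ∧
      Tendsto (fun k => ∫ s in (0:ℝ)..1, ‖deriv (v (φ k)) s - deriv w s‖ ^ 2) atTop (nhds 0) := by
  classical
  have hGb' : ∀ k, ∀ s ∈ Ioo (0:ℝ) 1, ‖deriv (v k) s‖ ≤ 1 + G s := by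
    intro k s hs
    nlinarith [hGb k s hs, sq_nonneg (‖deriv (v k) s‖ - 1)]
  -- extraction
  let X : ℕ → ℚ → E2 := fun k r => if (r : ℝ) ∈ Ioo (0:ℝ) 1 then deriv (v k) r else 0
  let B : ℚ → ℝ := fun r => max (1 + G r) 0
  have hK : IsCompact (Set.pi univ (fun r : ℚ => Metric.closedBall (0 : E2) (B r))) :=
    isCompact_univ_pi fun r => isCompact_closedBall _ _
  obtain ⟨a, -, φ, hφ, hlim⟩ := hK.tendsto_subseq (x := X) (by
    intro k r _
    simp only [X, B, mem_closedBall_zero_iff]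
    split_ifs with hr
    · exact (hGb' k r hr).trans (le_max_left _ _)
    · simp)
  have hrat : ∀ r : ℚ, (r : ℝ) ∈ Ioo (0:ℝ) 1 →
      CauchySeq (fun k => deriv (v (φ k)) r) := by
    intro r hr
    have h1 := (tendsto_pi_nhds.1 hlim r).cauchySeq
    refine (congrArg CauchySeq (funext fun k => ?_)).mp h1
    simp only [X, Function.comp_apply]
    rw [if_pos hr]
  have hcau : ∀ s ∈ Ioo (0:ℝ) 1, CauchySeq (fun k => deriv (v (φ k)) s) := by
    intro s hs
    obtain ⟨t0, ht0, ht01⟩ := exists_between hs.2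
    obtain ⟨C, hC⟩ := hlip t0 ht01
    rw [Metric.cauchySeq_iff']
    intro ε hε
    have hCp : 0 < |C| + 1 := by positivity
    obtain ⟨r, hr1, hr2⟩ := exists_rat_btwn
      (show s < min t0 (s + ε / 3 / (|C| + 1)) from lt_min ht0 (by
        have : 0 < ε / 3 / (|C| + 1) := by positivity
        linarith))
    have hrI : (r : ℝ) ∈ Ioo (0:ℝ) t0 := ⟨hs.1.trans hr1, hr2.trans_le (min_le_left _ _)⟩
    have hsI : s ∈ Ioo (0:ℝ) t0 := ⟨hs.1, ht0⟩
    have hrs : |(r:ℝ) - s| ≤ ε / 3 / (|C| + 1) := by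
      rw [abs_of_pos (by linarith)]
      have := hr2.trans_le (min_le_right _ _)
      linarith
    have hclose : ∀ k, ‖deriv (v (φ k)) r - deriv (v (φ k)) s‖ < ε / 3 := by
      intro k
      have h2 := hC (φ k) s hsI r hrI
      have hrp : 0 < |(r:ℝ) - s| := abs_pos.2 (by linarith)
      calc _ ≤ C * |(r:ℝ) - s| := h2
        _ < (|C| + 1) * |(r:ℝ) - s| := by
            apply mul_lt_mul_of_pos_right _ hrp
            linarith [le_abs_self C]
        _ ≤ (|C| + 1) * (ε / 3 / (|C| + 1)) := by gcongr
        _ = ε / 3 := by field_simp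
    obtain ⟨N, hN⟩ := Metric.cauchySeq_iff'.1 (hrat r ⟨hrI.1, hrI.2.trans ht01⟩) (ε / 3) (by positivity)
    refine ⟨N, fun n hn => ?_⟩
    have h1 := hN n hn
    rw [dist_eq_norm] at h1 ⊢
    have e : deriv (v (φ n)) s - deriv (v (φ N)) s =
      -(deriv (v (φ n)) r - deriv (v (φ n)) s) + (deriv (v (φ n)) r - deriv (v (φ N)) r)
        + (deriv (v (φ N)) r - deriv (v (φ N)) s) := by abel
    rw [e]
    refine (norm_add₃_le).trans_lt ?_
    rw [norm_neg]
    linarith [hclose n, hclose N]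
  have hex : ∀ s, ∃ y : E2, s ∈ Ioo (0:ℝ) 1 → Tendsto (fun k => deriv (v (φ k)) s) atTop (nhds y) := by
    intro s
    by_cases hs : s ∈ Ioo (0:ℝ) 1
    · obtain ⟨y, hy⟩ := cauchySeq_tendsto_of_complete (hcau s hs)
      exact ⟨y, fun _ => hy⟩
    · exact ⟨0, fun h => absurd h hs⟩
  choose W hW using hex
  have hWG : ∀ s ∈ Ioo (0:ℝ) 1, ‖W s‖ ^ 2 ≤ G s := fun s hs =>
    le_of_tendsto ((hW s hs).norm.pow 2) (Eventually.of_forall fun k => hGb _ s hs)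
  have hWc : ContinuousOn W (Ioo 0 1) := by
    intro s hs
    obtain ⟨t0, ht0, ht01⟩ := exists_between hs.2
    obtain ⟨C, hC⟩ := hlip t0 ht01
    have hl : ∀ t ∈ Ioo (0:ℝ) t0, ‖W t - W s‖ ≤ C * |t - s| := by
      intro t ht
      exact le_of_tendsto ((hW t ⟨ht.1, ht.2.trans ht01⟩).sub (hW s hs)).norm
        (Eventually.of_forall fun k => hC _ s ⟨hs.1, ht0⟩ t ht)
    refine ContinuousAt.continuousWithinAt ?_
    rw [ContinuousAt, tendsto_iff_norm_sub_tendsto_zero]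
    refine squeeze_zero' (Eventually.of_forall fun _ => norm_nonneg _)
      (g := fun t => C * |t - s|) ?_ ?_
    · filter_upwards [Ioo_mem_nhds hs.1 ht0] with t ht using hl t ht
    · have : Continuous (fun t : ℝ => C * |t - s|) := by fun_prop
      have := this.tendsto s
      simpa using this
  have hWm : AEStronglyMeasurable W (volume.restrict (uIoc (0:ℝ) 1)) := by
    rw [uIoc_of_le zero_le_one, ← Measure.restrict_congr_set Ioo_ae_eq_Ioc]
    exact hWc.aestronglyMeasurable measurableSet_Ioo
  have hG1 : IntervalIntegrable (fun s => 1 + G s) volume 0 1 :=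
    (continuous_const.intervalIntegrable 0 1).add hG
  have hWi : IntervalIntegrable W volume 0 1 := by
    refine IntervalIntegrable.mono_fun' hG1 hWm ?_
    refine (ae_restrict_iff' measurableSet_uIoc).2 (ae_Ioo_of fun s hs => ?_)
    nlinarith [hWG s hs, sq_nonneg (‖W s‖ - 1)]
  have hdi : ∀ k, IntervalIntegrable (deriv (v k)) volume 0 1 := by
    intro k
    refine IntervalIntegrable.mono_fun' hG1
      (stronglyMeasurable_deriv (v k)).aestronglyMeasurable ?_
    exact (ae_restrict_iff' measurableSet_uIoc).2 (ae_Ioo_of fun s hs => hGb' k s hs)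
  let w : ℝ → E2 := fun s => q + ∫ x in (0:ℝ)..s, W x
  have hsub : ∀ s ∈ Icc (0:ℝ) 1, uIoc (0:ℝ) s ⊆ uIoc (0:ℝ) 1 := by
    intro s hs
    rw [uIoc_of_le hs.1, uIoc_of_le zero_le_one]
    exact Ioc_subset_Ioc_right hs.2
  have hsubi : ∀ s ∈ Icc (0:ℝ) 1, uIcc (0:ℝ) s ⊆ uIcc (0:ℝ) 1 := by
    intro s hs
    rw [uIcc_of_le hs.1, uIcc_of_le zero_le_one]
    exact Icc_subset_Icc_right hs.2
  have hvw : ∀ s ∈ Icc (0:ℝ) 1, Tendsto (fun k => v (φ k) s) atTop (nhds (w s)) := by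
    intro s hs
    have h1 : ∀ k, v k s = v k 0 + ∫ x in (0:ℝ)..s, deriv (v k) x := by
      intro k
      rw [integral_eq_sub_of_hasDerivAt_of_le hs.1 ((hc k).mono (Icc_subset_Icc_right hs.2))
        (fun x hx => (hd k x ⟨hx.1, hx.2.trans_le hs.2⟩).hasDerivAt)
        ((hdi k).mono_set (hsubi s hs))]
      abel
    have h2 : Tendsto (fun k => ∫ x in (0:ℝ)..s, deriv (v (φ k)) x) atTop
        (nhds (∫ x in (0:ℝ)..s, W x)) := by
      refine intervalIntegral.tendsto_integral_filter_of_dominated_convergence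
        (fun s => 1 + G s) ?_ ?_ (hG1.mono_set (hsubi s hs)) ?_
      · exact Eventually.of_forall fun k => (stronglyMeasurable_deriv _).aestronglyMeasurable
      · refine Eventually.of_forall fun k => ?_
        filter_upwards [ae_Ioo_of (hGb' (φ k))] with x hx hxs
        exact hx (hsub s hs hxs)
      · filter_upwards [ae_Ioo_of hW] with x hx hxs
        exact hx (hsub s hs hxs)
    have h3 := (hv0.comp hφ.tendsto_atTop).add h2
    refine h3.congr fun k => ?_
    rw [h1 (φ k)]; rfl
  have hwd : ∀ s ∈ Ioo (0:ℝ) 1, HasDerivAt w (W s) s := by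
    intro s hs
    refine HasDerivAt.const_add q (integral_hasDerivAt_right
      (hWi.mono_set (hsubi s (Ioo_subset_Icc_self hs)))
      (hWc.stronglyMeasurableAtFilter isOpen_Ioo s hs)
      (hWc.continuousAt (isOpen_Ioo.mem_nhds hs)))
  have hwc : ContinuousOn w (Icc 0 1) := by
    have := continuousOn_primitive_interval' hWi left_mem_uIcc
    rw [uIcc_of_le zero_le_one] at this
    exact continuousOn_const.add this
  have hw1 : w 1 = 0 := by
    refine tendsto_nhds_unique (hvw 1 (by simp)) ?_
    simp [hv1]
  have hWsq : IntervalIntegrable (fun s => ‖W s‖ ^ 2) volume 0 1 := by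
    refine IntervalIntegrable.mono_fun' hG (hWm.norm.pow 2) ?_
    refine (ae_restrict_iff' measurableSet_uIoc).2 (ae_Ioo_of fun s hs => ?_)
    show ‖‖W s‖ ^ 2‖ ≤ G s
    rw [Real.norm_of_nonneg (by positivity)]
    exact hWG s hs
  have hwW : ∀ s ∈ Ioo (0:ℝ) 1, ‖deriv w s‖ ^ 2 = ‖W s‖ ^ 2 := fun s hs => by rw [(hwd s hs).deriv]
  refine ⟨φ, w, hφ, hwc, fun s hs => (hwd s hs).differentiableAt, by simp [w], hw1, hvw,
    congr_Ioo_integrable hwW hWsq, ?_, ?_, ?_⟩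
  · rw [congr_Ioo_integral hwW]
    refine intervalIntegral.tendsto_integral_filter_of_dominated_convergence G ?_ ?_ hG ?_
    · exact Eventually.of_forall fun k => (stronglyMeasurable_deriv _).aestronglyMeasurable.norm.pow 2
    · refine Eventually.of_forall fun k => ae_Ioo_of fun s hs => ?_
      rw [Real.norm_of_nonneg (by positivity)]
      exact hGb _ s hs
    · exact ae_Ioo_of fun s hs => (hW s hs).norm.pow 2
  · have hwR : ∀ s ∈ Icc (0:ℝ) 1, ‖w s‖ ≤ R := fun s hs =>
      le_of_tendsto (hvw s hs).norm (Eventually.of_forall fun k => hR _ s hs)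
    have h0 : (0:ℝ) = ∫ s in (0:ℝ)..1, (0:ℝ) := by simp
    nth_rw 2 [h0]
    refine intervalIntegral.tendsto_integral_filter_of_dominated_convergence
      (fun _ => (2 * R) ^ 2) ?_ ?_ (by simp) ?_
    · refine Eventually.of_forall fun k => ?_
      rw [uIoc_of_le zero_le_one]
      exact ((((hc _).sub hwc).norm.pow 2).mono Ioc_subset_Icc_self).aestronglyMeasurable
        measurableSet_Ioc
    · refine Eventually.of_forall fun k => ae_Ioo_of fun s hs => ?_
      have hs' := Ioo_subset_Icc_self hs
      rw [Real.norm_of_nonneg (by positivity)]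
      have : ‖v (φ k) s - w s‖ ≤ 2 * R :=
        (norm_sub_le _ _).trans (by linarith [hR (φ k) s hs', hwR s hs'])
      gcongr
    · refine ae_Ioo_of fun s hs => ?_
      have := ((hvw s (Ioo_subset_Icc_self hs)).sub_const (w s)).norm.pow 2
      simpa using this
  · have h0 : (0:ℝ) = ∫ s in (0:ℝ)..1, (0:ℝ) := by simp
    nth_rw 2 [h0]
    refine intervalIntegral.tendsto_integral_filter_of_dominated_convergence
      (fun s => 4 * G s) ?_ ?_ (hG.const_mul 4) ?_
    · refine Eventually.of_forall fun k => ?_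
      exact ((stronglyMeasurable_deriv _).aestronglyMeasurable.sub
        (stronglyMeasurable_deriv _).aestronglyMeasurable).norm.pow 2
    · refine Eventually.of_forall fun k => ae_Ioo_of fun s hs => ?_
      rw [Real.norm_of_nonneg (by positivity), (hwd s hs).deriv]
      have h1 := norm_sub_le (deriv (v (φ k)) s) (W s)
      have h2 := hGb (φ k) s hs
      have h3 := hWG s hs
      have h4 : ‖deriv (v (φ k)) s - W s‖ ^ 2 ≤ (‖deriv (v (φ k)) s‖ + ‖W s‖) ^ 2 := by gcongr
      nlinarith [sq_nonneg (‖deriv (v (φ k)) s‖ - ‖W s‖)]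
    · refine ae_Ioo_of fun s hs => ?_
      rw [(hwd s hs).deriv]
      have := ((hW s hs).sub_const (W s)).norm.pow 2
      simpa using this

lemma circlePt_norm {r : ℝ} (hr : 0 < r) (θ : ℝ) : ‖circlePt r θ‖ = r := by
  unfold circlePt
  rw [norm_smul, Real.norm_of_nonneg hr.le, EuclideanSpace.norm_eq]
  simp

lemma bound_int {α C : ℝ} (hα : α ∈ Ioo (0:ℝ) 2) :
    IntervalIntegrable (fun s : ℝ => C * ((1 - s) ^ (2 / (2 + α))) ^ (-α)) volume 0 1 := by
  obtain ⟨h0, h2⟩ := hα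
  have h1 : IntervalIntegrable (fun s : ℝ => (1 - s) ^ (2 / (2 + α) * (-α))) volume 0 1 := by
    have hr : -1 < 2 / (2 + α) * (-α) := by
      rw [div_mul_eq_mul_div, lt_div_iff₀ (by linarith)]; linarith
    have := (intervalIntegrable_rpow' (a := 0) (b := 1) hr).comp_sub_left 1
    simpa using this.symm
  refine (congr_Ioo_integrable (fun s hs => ?_) h1).const_mul C
  rw [Real.rpow_mul (by linarith [hs.2])]

/-- Compactness of minimizing sequences: if `u_k` minimizes `M_{h_k}` on
`H_coll^{q_k}`, then up to a subsequence `u_k → u*` strongly in `H¹`, and `u*`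
minimizes `M_{h*}` on `H_coll^{q*}`. -/
theorem minimizers_compactness
    (α h hstar Umin rstar θstar : ℝ) (hα : α ∈ Set.Ioo (0:ℝ) 2) (hh : h < 0)
    (U : EuclideanSpace ℝ (Fin 2) → ℝ) (hUC2 : ContDiff ℝ 2 U)
    (hUmin : ∀ s : EuclideanSpace ℝ (Fin 2), ‖s‖ = 1 → Umin ≤ U s)
    (hUminpos : 0 < Umin)
    (hrstar : 0 < rstar) (hrstarLJ : rstar < ((2 - α) * Umin / (-2 * h)) ^ (1/α))
    (hhstar : hstar ∈ Set.Ioo h 0)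
    (hk : ℕ → ℝ) (rk : ℕ → ℝ) (θk : ℕ → ℝ)
    (hhk : ∀ k, hk k ∈ Set.Ioo h 0) (hhklim : Tendsto hk atTop (nhds hstar))
    (hrk : ∀ k, 0 < rk k ∧ rk k < ((2 - α) * Umin / (-2 * h)) ^ (1/α))
    (hrklim : Tendsto rk atTop (nhds rstar))
    (hqklim : Tendsto (fun k => circlePt (rk k) (θk k)) atTop
      (nhds (circlePt rstar θstar)))
    (u : ℕ → ℝ → EuclideanSpace ℝ (Fin 2))
    (hadm : ∀ k, HcollQ α (hk k) U (circlePt (rk k) (θk k)) (u k))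
    (hmin : ∀ k, ∀ v, HcollQ α (hk k) U (circlePt (rk k) (θk k)) v →
      Maupertuis α (hk k) U (u k) ≤ Maupertuis α (hk k) U v) :
    ∃ (φ : ℕ → ℕ) (ustar : ℝ → EuclideanSpace ℝ (Fin 2)),
      StrictMono φ ∧
      Tendsto (fun k =>
        (∫ s in (0:ℝ)..1, ‖u (φ k) s - ustar s‖ ^ 2) +
        (∫ s in (0:ℝ)..1, ‖deriv (u (φ k)) s - deriv ustar s‖ ^ 2))
        atTop (nhds 0) ∧
      HcollQ α hstar U (circlePt rstar θstar) ustar ∧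
      (∀ v, HcollQ α hstar U (circlePt rstar θstar) v →
        Maupertuis α hstar U ustar ≤ Maupertuis α hstar U v) := by
  obtain ⟨hα0, hα2⟩ := id hα
  have hUc := hUC2.continuous
  obtain ⟨Umax, hUm0, hUmax⟩ := exists_Umax hUc
  obtain ⟨R, hR1, hR2⟩ := exists_between hrstarLJ
  have hR0 : 0 < R := hrstar.trans hR1
  obtain ⟨κ, hκ, hκV⟩ := kappa_exists (U := U) hα hh hUmin hUminpos hR0 hR2
  set q : ℕ → E2 := fun k => circlePt (rk k) (θk k) with hqdef
  set qs : E2 := circlePt rstar θstar with hqs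
  have hqn : ∀ k, ‖q k‖ = rk k := fun k => circlePt_norm (hrk k).1 _
  have hqsn : ‖qs‖ = rstar := circlePt_norm hrstar _
  have hq0 : ∀ k, q k ≠ 0 := fun k => norm_pos_iff.1 (by rw [hqn]; exact (hrk k).1)
  have hqs0 : qs ≠ 0 := norm_pos_iff.1 (by rw [hqsn]; exact hrstar)
  have hIs : ∀ k, IsMinim α (hk k) U (q k) (u k) := fun k => ⟨hadm k, hmin k⟩
  -- competitors
  have hcomp : ∀ v, HcollQ α hstar U qs v →
      (∀ k, Maupertuis α (hk k) U (u k) ≤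
        Maupertuis α (hk k) U (fun s => Lsim qs (q k) (v s))) ∧
      Tendsto (fun k => Maupertuis α (hk k) U (fun s => Lsim qs (q k) (v s))) atTop
        (nhds (Maupertuis α hstar U v)) := by
    intro v hv
    exact ⟨fun k => hmin k _ (Lsim_Hcoll hα0 hUc hUmin hUminpos hv hqs0 (hq0 k)),
      Lsim_Maup hα0 hUC2 hUmin hUminpos hv hqs0 hq0 hqklim hhklim⟩
  obtain ⟨hc1, hc2⟩ := hcomp _ (Lsim_Hcoll (h' := hstar) hα0 hUc hUmin hUminpos (hadm 0) (hq0 0) hqs0)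
  set C0 := Maupertuis α hstar U (fun s => Lsim (q 0) qs (u 0 s)) + 1 with hC0
  obtain ⟨N, hN⟩ := eventually_atTop.1 ((hc2.eventually_le_const (lt_add_one _)).and
    ((hrklim.eventually_le_const hR1).and
      (hrklim.eventually_const_le (show rstar / 2 < rstar by linarith))))
  set p0 := α / 2 * (Umin * R ^ (-α)) with hp0
  have hp0p : 0 < p0 := by positivity
  set a0 := (rstar / 2) ^ 2 with ha0
  have ha0p : 0 < a0 := by positivity
  have hPk : ∀ k, N ≤ k → p0 ≤ ∫ s in (0:ℝ)..1, (hk k + Vpot α U (u k s)) := fun k hk1 =>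
    P_lower (hadm k) ((hqn k).le.trans (hN k hk1).2.1)
      (fun x hx hxR => (hκV (hk k) (hhk k).1 x hx hxR).2)
  have hAk : ∀ k, N ≤ k → a0 ≤ ∫ s in (0:ℝ)..1, ‖deriv (u k) s‖ ^ 2 := fun k hk1 => by
    refine le_trans ?_ (A_lower (hadm k) (hq0 k))
    have := hqn k
    have h2 := (hN k hk1).2.2
    rw [ha0]
    change (rstar / 2) ^ 2 ≤ ‖q k‖ ^ 2
    rw [hqn k]
    gcongr
  have hMk : ∀ k, N ≤ k → 1 / 2 * (∫ s in (0:ℝ)..1, ‖deriv (u k) s‖ ^ 2) *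
      (∫ s in (0:ℝ)..1, (hk k + Vpot α U (u k s))) ≤ C0 := fun k hk1 =>
    (hc1 k).trans (hN k hk1).1
  have hC0p : 0 < C0 := by
    have h1 := hPk N le_rfl
    have h2 := hAk N le_rfl
    refine lt_of_lt_of_le ?_ (hMk N le_rfl)
    have := hp0p.trans_le h1
    have := ha0p.trans_le h2
    positivity
  set lmin := a0 / 2 / (2 * C0 / a0) with hlmin
  set lmax := (2 * C0 / p0) / 2 / p0 with hlmax
  have hlminp : 0 < lmin := by positivity
  have hlmaxp : 0 < lmax := by positivity
  have hlk : ∀ k, N ≤ k →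
      lmin ≤ (∫ s in (0:ℝ)..1, ‖deriv (u k) s‖ ^ 2) / 2 /
        (∫ s in (0:ℝ)..1, (hk k + Vpot α U (u k s))) ∧
      (∫ s in (0:ℝ)..1, ‖deriv (u k) s‖ ^ 2) / 2 /
        (∫ s in (0:ℝ)..1, (hk k + Vpot α U (u k s))) ≤ lmax := by
    intro k hk1
    have h1 := hPk k hk1
    have h2 := hAk k hk1
    have h3 := hMk k hk1
    set A := ∫ s in (0:ℝ)..1, ‖deriv (u k) s‖ ^ 2
    set P := ∫ s in (0:ℝ)..1, (hk k + Vpot α U (u k s))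
    have hPp : 0 < P := hp0p.trans_le h1
    have hAp : 0 < A := ha0p.trans_le h2
    have h4 : A ≤ 2 * C0 / p0 := by
      rw [le_div_iff₀ hp0p]
      nlinarith
    have h5 : P ≤ 2 * C0 / a0 := by
      rw [le_div_iff₀ ha0p]
      nlinarith
    constructor
    · rw [hlmin]; gcongr
    · rw [hlmax]; gcongr
  obtain ⟨c, hc0, hlow⟩ := collision_lower (U := U) hα hUC2 hUmin hUminpos hκ hlminp
  have hκk : ∀ k, N ≤ k → ∀ x : E2, x ≠ 0 → ‖x‖ ≤ ‖q k‖ →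
      κ * Vpot α U x ≤ 2 * hk k + (2 - α) * Vpot α U x := fun k hk1 x hx hxq =>
    (hκV (hk k) (hhk k).1 x hx (hxq.trans ((hqn k).le.trans (hN k hk1).2.1))).1
  have hPp : ∀ k, N ≤ k → 0 < ∫ s in (0:ℝ)..1, (hk k + Vpot α U (u k s)) := fun k hk1 =>
    hp0p.trans_le (hPk k hk1)
  have hlowk : ∀ k, N ≤ k → ∀ s ∈ Ioo (0:ℝ) 1, c * (1 - s) ^ (2 / (2 + α)) ≤ ‖u k s‖ :=
    fun k hk1 => hlow (hk k) (q k) (u k) (hIs k) (hq0 k) (hκk k hk1) (hPp k hk1) (hlk k hk1).1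
  have hVnn := Vpot_nonneg (U := U) hα0 hUmin hUminpos
  have hnb : ∀ k, N ≤ k → ∀ s ∈ Ioo (0:ℝ) 1, u k s ≠ 0 ∧ ‖u k s‖ < ‖q k‖ := fun k hk1 =>
    norm_bounds hα hUmin hUminpos (hIs k)
      (fun x hx hxq => (mul_nonneg hκ.le (hVnn x)).trans (hκk k hk1 x hx hxq)) (hPp k hk1) (hq0 k)
  have hen := fun k (hk1 : N ≤ k) => energy_all hUC2 (hIs k) (hPp k hk1) (hnb k hk1)
  have hel := fun k (hk1 : N ≤ k) => el_strong hUC2 (hIs k) (hPp k hk1) (hnb k hk1)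
  set B : ℝ → ℝ := fun s => Umax * c ^ (-α) * ((1 - s) ^ (2 / (2 + α))) ^ (-α) with hB
  have hBi : IntervalIntegrable B volume 0 1 := bound_int hα
  have hVB : ∀ x : E2, ∀ s ∈ Ioo (0:ℝ) 1, c * (1 - s) ^ (2 / (2 + α)) ≤ ‖x‖ →
      x ≠ 0 ∧ Vpot α U x ≤ B s := by
    intro x s hs hx
    have h1s : 0 < 1 - s := by linarith [hs.2]
    have hp : 0 < c * (1 - s) ^ (2 / (2 + α)) := by positivity
    have hx0 : x ≠ 0 := norm_pos_iff.1 (hp.trans_le hx)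
    refine ⟨hx0, (Vpot_le hUmax hx0).trans ?_⟩
    have := Real.rpow_le_rpow_of_nonpos hp hx (show -α ≤ 0 by linarith)
    rw [Real.mul_rpow hc0.le (by positivity)] at this
    simp only [hB]
    rw [mul_assoc]
    gcongr
  have hRk : ∀ k, N ≤ k → ∀ s ∈ Icc (0:ℝ) 1, ‖u k s‖ ≤ R := fun k hk1 s hs =>
    ((hadm k).2.2.2.2.1 s hs).trans ((hqn k).le.trans (hN k hk1).2.1)
  have hNk : ∀ k, N ≤ k + N := fun k => Nat.le_add_left _ _
  obtain ⟨φ, w, hφ, hwc, hwd, hw0, hw1, hvw, hwi, hA, hL2, hD2⟩ :=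
    compact_abstract (v := fun k => u (k + N)) (G := fun s => 2 * lmax * B s) (q := qs) (R := R)
    (fun k => (hadm _).1) (fun k => (hadm _).2.1) (fun k => (hadm _).2.2.2.1)
    (by
      have h1 : ∀ k, u (k + N) 0 = q (k + N) := fun k => (hadm _).2.2.1
      simp only [h1]
      exact hqklim.comp (tendsto_add_atTop_nat N))
    (fun k => hRk _ (hNk k)) (hBi.const_mul _)
    (by
      intro k s hs
      rw [hen _ (hNk k) s hs]
      have h1 := (hVB _ s hs (hlowk _ (hNk k) s hs)).2
      have h2 := (hlk _ (hNk k))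
      have h3 : hk (k + N) + Vpot α U (u (k + N) s) ≤ B s := by linarith [(hhk (k + N)).2]
      have h4 : 0 ≤ B s := (hVnn _).trans h1
      refine (mul_le_mul_of_nonneg_left h3 (by linarith [hlminp.le.trans h2.1])).trans ?_
      exact mul_le_mul_of_nonneg_right (by linarith [h2.2]) h4)
    (by
      intro t0 ht0
      have hd : 0 < c * (1 - t0) ^ (2 / (2 + α)) := by
        have : 0 < 1 - t0 := by linarith
        positivity
      obtain ⟨C, hC0, hC⟩ := Vpot_fderiv_bound α hUC2 (R := R) hd
      refine ⟨lmax * C, fun k s hs t ht => ?_⟩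
      have hmv := Convex.norm_image_sub_le_of_norm_hasDerivWithin_le (𝕜 := ℝ)
        (f := deriv (u (k + N))) (s := Ioo 0 t0) (x := s) (y := t) (C := lmax * C)
        (fun x hx => (hel _ (hNk k) x ⟨hx.1, hx.2.trans ht0⟩).hasDerivWithinAt)
        (fun x hx => ?_) (convex_Ioo 0 t0) hs ht
      · simpa using hmv
      · have hx1 : x ∈ Ioo (0:ℝ) 1 := ⟨hx.1, hx.2.trans ht0⟩
        have h2 := (hlk _ (hNk k))
        rw [norm_smul, Real.norm_of_nonneg (hlminp.le.trans h2.1)]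
        have h3 : ‖gradient (Vpot α U) (u (k + N) x)‖ ≤ C := by
          have : ‖gradient (Vpot α U) (u (k + N) x)‖ = ‖fderiv ℝ (Vpot α U) (u (k + N) x)‖ := by
            unfold gradient; exact LinearIsometryEquiv.norm_map _ _
          rw [this]
          refine hC _ (le_trans ?_ (hlowk _ (hNk k) x hx1))
            (hRk _ (hNk k) x (Ioo_subset_Icc_self hx1))
          have : 0 ≤ 1 - t0 := by linarith
          have : 1 - t0 ≤ 1 - x := by linarith [hx.2]
          gcongr
        exact mul_le_mul h2.2 h3 (norm_nonneg _) hlmaxp.le)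
  have hψ : StrictMono (fun k => φ k + N) := fun a b hab => Nat.add_lt_add_right (hφ hab) N
  have hwlow : ∀ s ∈ Ioo (0:ℝ) 1, c * (1 - s) ^ (2 / (2 + α)) ≤ ‖w s‖ := fun s hs =>
    ge_of_tendsto (hvw s (Ioo_subset_Icc_self hs)).norm
      (Eventually.of_forall fun k => hlowk _ (hNk _) s hs)
  have hwm : AEStronglyMeasurable (fun s => Vpot α U (w s)) (volume.restrict (uIoc (0:ℝ) 1)) := by
    rw [uIoc_of_le zero_le_one]
    have h1 : AEStronglyMeasurable w (volume.restrict (Ioc 0 1)) :=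
      (hwc.mono Ioc_subset_Icc_self).aestronglyMeasurable measurableSet_Ioc
    exact ((Vpot_measurable α hUc).comp_aemeasurable h1.aemeasurable).aestronglyMeasurable
  have hwV : IntervalIntegrable (fun s => Vpot α U (w s)) volume 0 1 := by
    refine IntervalIntegrable.mono_fun' hBi hwm ?_
    refine (ae_restrict_iff' measurableSet_uIoc).2 (ae_Ioo_of fun s hs => ?_)
    show ‖Vpot α U (w s)‖ ≤ B s
    rw [Real.norm_of_nonneg (hVnn _)]
    exact (hVB _ s hs (hwlow s hs)).2
  have hwH : HcollQ α hstar U qs w := by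
    refine ⟨hwc, hwd, hw0, hw1, ?_, ?_, hwi, (continuous_const.intervalIntegrable 0 1).add hwV⟩
    · intro s hs
      refine le_of_tendsto_of_tendsto (hvw s hs).norm (hqklim.comp hψ.tendsto_atTop).norm
        (Eventually.of_forall fun k => ?_)
      exact (hadm _).2.2.2.2.1 s hs
    · filter_upwards [ae_ne_pt 0, ae_ne_pt 1] with s h0 h1 hs
      have hs' : s ∈ Ioo (0:ℝ) 1 := ⟨lt_of_le_of_ne hs.1 (Ne.symm h0), lt_of_le_of_ne hs.2 h1⟩
      exact (hVB _ s hs' (hwlow s hs')).1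
  have hMlim : Tendsto (fun k => Maupertuis α (hk (φ k + N)) U (u (φ k + N))) atTop
      (nhds (Maupertuis α hstar U w)) := by
    unfold Maupertuis
    refine Tendsto.mul (Tendsto.const_mul _ hA) ?_
    have hsplit : ∀ k, (∫ s in (0:ℝ)..1, (hk k + Vpot α U (u k s))) =
        hk k + ∫ s in (0:ℝ)..1, Vpot α U (u k s) := by
      intro k
      rw [intervalIntegral.integral_add (by simp) (Vpot_int (hadm k))]
      simp
    have hsplit' : (∫ s in (0:ℝ)..1, (hstar + Vpot α U (w s))) =
        hstar + ∫ s in (0:ℝ)..1, Vpot α U (w s) := by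
      rw [intervalIntegral.integral_add (by simp) hwV]
      simp
    simp only [hsplit, hsplit']
    refine (hhklim.comp hψ.tendsto_atTop).add ?_
    refine intervalIntegral.tendsto_integral_filter_of_dominated_convergence B ?_ ?_ hBi ?_
    · exact Eventually.of_forall fun k => (by
        rw [uIoc_of_le zero_le_one]; exact (Vpot_int (hadm _)).1.aestronglyMeasurable)
    · refine Eventually.of_forall fun k => ae_Ioo_of fun s hs => ?_
      rw [Real.norm_of_nonneg (hVnn _)]
      exact (hVB _ s hs (hlowk _ (hNk _) s hs)).2
    · refine ae_Ioo_of fun s hs => ?_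
      exact (Vpot_continuousAt α hUC2 (hVB _ s hs (hwlow s hs)).1).tendsto.comp
        (hvw s (Ioo_subset_Icc_self hs))
  refine ⟨fun k => φ k + N, w, hψ, ?_, hwH, ?_⟩
  · have := hL2.add hD2
    rw [add_zero] at this
    exact this
  · intro v hv
    obtain ⟨h1, h2⟩ := hcomp v hv
    exact le_of_tendsto_of_tendsto hMlim (h2.comp hψ.tendsto_atTop)
      (Eventually.of_forall fun k => h1 _)
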